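/- arXiv:1610.02157 — 2 statements merged into one kernel-verified Lean document; each statement's English description precedes it below -/
import Mathlib

section
/- Let n ≥ 1 and let ψ : [0,∞) → [0,∞) be a non-increasing function. Then Σ_{k=1}^∞ ψ(k) < ∞ if and only if Σ_{q ∈ ℤ^n∖{0}} ψ(‖q‖^n) < ∞. -/
open MeasureTheory Metric Set
open scoped BigOperators ENNReal

noncomputable section

/-- `x̃ = (1, x)` -/
def tilde {s : ℕ} (x : Fin s → ℝ) : Fin (s + 1) → ℝ := Fin.cons 1 x

/-- The parametrization `x ↦ (x, x̃A)` of the affine subspace. -/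
def phiA {s m : ℕ} (A : Matrix (Fin (s + 1)) (Fin m) ℝ) (x : Fin s → ℝ) :
    Fin (s + m) → ℝ :=
  Fin.append x (Matrix.vecMul (tilde x) A)

/-- `(x, x̃A) · q + p`. -/
def dotA {s m : ℕ} (A : Matrix (Fin (s + 1)) (Fin m) ℝ) (x : Fin s → ℝ)
    (q : Fin (s + m) → ℤ) : ℝ :=
  ∑ j, phiA A x j * (q j : ℝ)

/-- The gradient `[Id_s A'] q` of `x ↦ (x, x̃A)·q`. -/
def gradA {s m : ℕ} (A : Matrix (Fin (s + 1)) (Fin m) ℝ) (q : Fin (s + m) → ℤ) :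
    Fin s → ℝ :=
  fun i => (q (Fin.castAdd m i) : ℝ) + ∑ j, A i.succ j * (q (Fin.natAdd s j) : ℝ)

/-- Coordinate `⟨e_i ∧ e_J, w⟩` of the map `c` (zero unless `J ⊆ {1,…,n}` and `i ∉ J`). -/
def cMap {n : ℕ} (w : Finset (Fin (n + 1)) → ℝ) (i : Fin (n + 1))
    (J : Finset (Fin (n + 1))) : ℝ :=
  if (0 : Fin (n + 1)) ∈ J ∨ i ∈ J then 0
  else (-1 : ℝ) ^ (J.filter (· < i)).card * w (insert i J)

/-- The matrix `R_A = (Id_{s+1} | A)`. -/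
def RA {s m : ℕ} (A : Matrix (Fin (s + 1)) (Fin m) ℝ) :
    Matrix (Fin (s + 1)) (Fin (s + m + 1)) ℝ :=
  fun a i =>
    if h : (i : ℕ) < s + 1 then (if (i : ℕ) = (a : ℕ) then 1 else 0)
    else A a ⟨(i : ℕ) - (s + 1), by omega⟩

/-- Coordinates of `R_A c(w)`. -/
def RAc {s m : ℕ} (A : Matrix (Fin (s + 1)) (Fin m) ℝ)
    (w : Finset (Fin (s + m + 1)) → ℝ) (a : Fin (s + 1)) (J : Finset (Fin (s + m + 1))) : ℝ :=
  ∑ i, RA A a i * cMap w i J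

/-- Euclidean norm of `R_A c(w)`. -/
def RAcNorm {s m : ℕ} (A : Matrix (Fin (s + 1)) (Fin m) ℝ)
    (w : Finset (Fin (s + m + 1)) → ℝ) : ℝ :=
  Real.sqrt (∑ a, ∑ J, (RAc A w a J) ^ 2)

/-- Euclidean norm of the projection `π_•(w)` onto `⋀(W_{s+1→n})`. -/
def pibullNorm (s : ℕ) {n : ℕ} (w : Finset (Fin (n + 1)) → ℝ) : ℝ :=
  Real.sqrt (∑ S : Finset (Fin (n + 1)),
    if ∀ i ∈ S, s < (i : ℕ) then (w S) ^ 2 else 0)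

/-- Euclidean norm of an exterior vector in coordinates. -/
def extNorm {N : ℕ} (w : Finset (Fin N) → ℝ) : ℝ :=
  Real.sqrt (∑ S : Finset (Fin N), (w S) ^ 2)

/-- Euclidean norm of the projection `π(w)` onto `⋀(W_{1→n})`. -/
def piNorm {n : ℕ} (w : Finset (Fin (n + 1)) → ℝ) : ℝ :=
  Real.sqrt (∑ S : Finset (Fin (n + 1)),
    if (0 : Fin (n + 1)) ∉ S then (w S) ^ 2 else 0)

/-- `w` has pure degree `k`. -/
def ExtDeg {N : ℕ} (k : ℕ) (w : Finset (Fin N) → ℝ) : Prop :=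
  ∀ S, S.card ≠ k → w S = 0

/-- The set of exponents `v` appearing in the definition of `ω_j(A)`. -/
def expSet (s m : ℕ) (A : Matrix (Fin (s + 1)) (Fin m) ℝ) (j : ℕ) : Set ℝ :=
  {v | 0 < v ∧ ∀ M : ℝ, ∃ w : Finset (Fin (s + m + 1)) → ℤ,
    (∀ S, S.card ≠ j → w S = 0) ∧
    M < pibullNorm s (fun S => (w S : ℝ)) ∧
    RAcNorm A (fun S => (w S : ℝ)) <
      pibullNorm s (fun S => (w S : ℝ)) ^ (-(v + 1 - j) / j)}

/-- `ω_j(A) < n` for all `j = 1, …, n − s`  (here `n = s + m`). -/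
def DiophCond (s m : ℕ) (A : Matrix (Fin (s + 1)) (Fin m) ℝ) : Prop :=
  ∀ j : ℕ, 1 ≤ j → j ≤ m → ∃ v : ℝ, v < (s + m : ℕ) ∧ ∀ u ∈ expSet s m A j, u ≤ v

/-- Action of a matrix on exterior coordinates (compound matrix action). -/
def extAction {N : ℕ} (M : Matrix (Fin N) (Fin N) ℝ) (w : Finset (Fin N) → ℝ) :
    Finset (Fin N) → ℝ :=
  fun S => ∑ T : Finset (Fin N),
    if h : T.card = S.card then
      (Matrix.of fun a b : Fin S.card =>
          M (S.orderEmbOfFin rfl a) (T.orderEmbOfFin h b)).det * w T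
    else 0

/-- The wedge `v_1 ∧ ⋯ ∧ v_k` of vectors, in coordinates. -/
def wedgeOf {N k : ℕ} (v : Fin k → (Fin N → ℝ)) : Finset (Fin N) → ℝ :=
  fun S =>
    if h : S.card = k then
      (Matrix.of fun a b : Fin k => v a (S.orderEmbOfFin h b)).det
    else 0

/-- Sign for the wedge product of basis monomials. -/
def wedgeSign {N : ℕ} (T T' : Finset (Fin N)) : ℝ :=
  (-1) ^ (∑ a ∈ T, (T'.filter (· < a)).card)

/-- The wedge (exterior) product in coordinates. -/
def wedgeMul {N : ℕ} (u w : Finset (Fin N) → ℝ) : Finset (Fin N) → ℝ :=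
  fun S => ∑ T ∈ S.powerset, wedgeSign T (S \ T) * u T * w (S \ T)

/-- The unipotent matrix `u_x` on `ℝ^{1+s+n}`, `n = s+m`, with block rows
`(1, 0, x, x̃A)`, `(0, I_s, I_s, A')`, `(0, 0, I_n)`. -/
def uMat {s m : ℕ} (A : Matrix (Fin (s + 1)) (Fin m) ℝ) (x : Fin s → ℝ) :
    Matrix (Fin (1 + s + (s + m))) (Fin (1 + s + (s + m))) ℝ :=
  fun i j =>
    if (i : ℕ) = 0 then
      if (j : ℕ) = 0 then 1
      else if h1 : (j : ℕ) < 1 + s then 0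
      else if h2 : (j : ℕ) < 1 + s + s then x ⟨(j : ℕ) - (1 + s), by omega⟩
      else ∑ a, tilde x a * A a ⟨(j : ℕ) - (1 + s + s), by have := j.isLt; omega⟩
    else if hi : (i : ℕ) < 1 + s then
      if (j : ℕ) = 0 then 0
      else if h1 : (j : ℕ) < 1 + s then (if (j : ℕ) = (i : ℕ) then 1 else 0)
      else if h2 : (j : ℕ) < 1 + s + s then (if (j : ℕ) = (i : ℕ) + s then 1 else 0)
      else A ⟨(i : ℕ), by omega⟩ ⟨(j : ℕ) - (1 + s + s), by have := j.isLt; omega⟩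
    else if j = i then 1 else 0

/-- The diagonal matrix `g_t = diag(ε/δ, ε/K, …, ε/K, ε/T, …, ε/T)` on `ℝ^{1+s+n}`. -/
def gMat (s m : ℕ) (δ K T ε : ℝ) :
    Matrix (Fin (1 + s + (s + m))) (Fin (1 + s + (s + m))) ℝ :=
  Matrix.diagonal fun i =>
    if (i : ℕ) = 0 then ε / δ else if (i : ℕ) < 1 + s then ε / K else ε / T

/-- The vector `(p, 0, …, 0, q) ∈ Λ ⊂ ℤ^{1+s+n}`. -/
def lamVec (s m : ℕ) (p : ℤ) (q : Fin (s + m) → ℤ) : Fin (1 + s + (s + m)) → ℝ :=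
  fun i =>
    if (i : ℕ) = 0 then (p : ℝ)
    else if h : (i : ℕ) < 1 + s then 0
    else (q ⟨(i : ℕ) - (1 + s), by have := i.isLt; omega⟩ : ℝ)

/-- The matrix `ũ_x` on `ℝ^{n+1}`, with block rows `(1, x, x̃A)` and `(0, I_n)`. -/
def utMat {s m : ℕ} (A : Matrix (Fin (s + 1)) (Fin m) ℝ) (x : Fin s → ℝ) :
    Matrix (Fin (s + m + 1)) (Fin (s + m + 1)) ℝ :=
  fun i j =>
    if (i : ℕ) = 0 then
      if h : (j : ℕ) = 0 then 1
      else phiA A x ⟨(j : ℕ) - 1, by have := j.isLt; omega⟩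
    else if j = i then 1 else 0

/-- The diagonal matrix `g̃_t = diag(ε/δ, ε/T, …, ε/T)` on `ℝ^{n+1}`. -/
def gtMat (s m : ℕ) (δ T ε : ℝ) : Matrix (Fin (s + m + 1)) (Fin (s + m + 1)) ℝ :=
  Matrix.diagonal fun i => if (i : ℕ) = 0 then ε / δ else ε / T

/-- The function `ν(w) = ‖π_*(w)‖`: the euclidean norm of the part of `w` involving at most
one of the starred basis vectors `e_{*1}, …, e_{*s}` (indices `1, …, s` of `ℝ^{1+s+n}`). -/
def nuFun (s m : ℕ) (w : Finset (Fin (1 + s + (s + m))) → ℝ) : ℝ :=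
  Real.sqrt (∑ S : Finset (Fin (1 + s + (s + m))),
    if (S.filter fun i : Fin (1 + s + (s + m)) => 1 ≤ (i : ℕ) ∧ (i : ℕ) < 1 + s).card ≤ 1
    then (w S) ^ 2 else 0)

/-- `δ := κ/2^{nt}`. -/
def deltaP (s m : ℕ) (κ : ℝ) (t : ℕ) : ℝ := κ / 2 ^ ((s + m) * t)

/-- `K := √(ns/(2r²))·2^{t/2}`. -/
def KofT (s m : ℕ) (r : ℝ) (t : ℕ) : ℝ :=
  Real.sqrt (((s + m : ℕ) : ℝ) * s / (2 * r ^ 2)) * 2 ^ ((t : ℝ) / 2)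

/-- `T := 2^{t+1}`. -/
def TofT (t : ℕ) : ℝ := 2 ^ (t + 1)

/-- `ε' := (δKT^{n−1})^{1/(n+1)}`. -/
def epsP' (s m : ℕ) (κ r : ℝ) (t : ℕ) : ℝ :=
  (deltaP s m κ t * KofT s m r t * TofT t ^ (s + m - 1)) ^ (1 / ((s + m : ℕ) + 1 : ℝ))

/-- `ε := 2^{βt} ε'`. -/
def epsP (s m : ℕ) (κ r β : ℝ) (t : ℕ) : ℝ :=
  (2 : ℝ) ^ (β * t) * epsP' s m κ r t

/-- `‖ỹ c(w)‖` where `ỹ = (1, x, x̃A) = x̃ R_A`. -/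
def ycNorm {s m : ℕ} (A : Matrix (Fin (s + 1)) (Fin m) ℝ) (x : Fin s → ℝ)
    (w : Finset (Fin (s + m + 1)) → ℝ) : ℝ :=
  Real.sqrt (∑ J : Finset (Fin (s + m + 1)),
    (∑ i, (Fin.cons (1 : ℝ) (phiA A x) : Fin (s + m + 1) → ℝ) i * cMap w i J) ^ 2)

/-- A function is `(C, α)`-good on `V ⊆ ℝ^s`. -/
def IsGood (s : ℕ) (C α : ℝ) (f : EuclideanSpace ℝ (Fin s) → ℝ)
    (V : Set (EuclideanSpace ℝ (Fin s))) : Prop :=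
  ∀ (y₀ : EuclideanSpace ℝ (Fin s)) (r : ℝ), 0 < r → ball y₀ r ⊆ V →
    ∀ ε : ℝ, 0 < ε →
      volume {x ∈ ball y₀ r | |f x| < ε} ≤
        ENNReal.ofReal (C * (ε / sSup ((fun y => |f y|) '' ball y₀ r)) ^ α) *
          volume (ball y₀ r)

/-- `V_s`: the volume of the `s`-dimensional euclidean unit ball. -/
def Vball (s : ℕ) : ℝ := (volume (ball (0 : EuclideanSpace ℝ (Fin s)) 1)).toReal

/-- `N_s`: the Besicovitch covering constant of `ℝ^s`. -/
def Nbes (s : ℕ) : ℕ := Besicovitch.multiplicity (EuclideanSpace ℝ (Fin s))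

/-- `K_s := 4^{2s+1} s^{s/2} N_s / V_s`. -/
def Kcst (s : ℕ) : ℝ :=
  4 ^ (2 * s + 1) * (s : ℝ) ^ ((s : ℝ) / 2) * (Nbes s : ℝ) / Vball s

/-- `Γ` is a primitive subgroup of `Λ`: `Γ ≤ Λ` and `Γ_ℝ ∩ Λ = Γ`. -/
def IsPrimitiveIn {d : ℕ} (Λ Γ : Submodule ℤ (Fin d → ℝ)) : Prop :=
  Γ ≤ Λ ∧
    (Submodule.span ℝ (Γ : Set (Fin d → ℝ))).restrictScalars ℤ ⊓ Λ = Γ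

/-- `u` is a basis of the discrete subgroup `Γ` (so `u₁ ∧ ⋯ ∧ u_j` represents `Γ`). -/
def Represents {d j : ℕ} (u : Fin j → (Fin d → ℝ)) (Γ : Submodule ℤ (Fin d → ℝ)) : Prop :=
  LinearIndependent ℝ u ∧ Submodule.span ℤ (Set.range u) = Γ

/-- `w = v₁ ∧ ⋯ ∧ v_k` represents the nonzero primitive rank-`k` subgroup of `ℤ^N`
generated by `v₁, …, v_k`. -/
def RepresentsPrimInt {N k : ℕ} (v : Fin k → (Fin N → ℤ)) (w : Finset (Fin N) → ℝ) : Prop :=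
  LinearIndependent ℝ (fun a => fun i => ((v a i : ℝ))) ∧
  (∀ z : Fin N → ℤ,
      ((fun i => (z i : ℝ)) ∈
        Submodule.span ℝ (Set.range fun a => fun i => ((v a i : ℝ)))) →
      z ∈ Submodule.span ℤ (Set.range v)) ∧
  w = wedgeOf fun a => fun i => ((v a i : ℝ))

/-- Two-sided mean value bound for the difference of two powers. -/
theorem pow_succ_sub_pow_succ_bounds (m : ℕ) {a b : ℝ} (ha : 0 ≤ a) (hab : a ≤ b) :
    (m + 1) * a ^ m * (b - a) ≤ b ^ (m + 1) - a ^ (m + 1) ∧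
      b ^ (m + 1) - a ^ (m + 1) ≤ (m + 1) * b ^ m * (b - a) := by
  have hb : 0 ≤ b := ha.trans hab
  have hsub : 0 ≤ b - a := sub_nonneg.2 hab
  have h : b ^ (m + 1) - a ^ (m + 1) =
      (∑ i ∈ Finset.range (m + 1), b ^ i * a ^ (m - i)) * (b - a) := by
    rw [← geom_sum₂_mul]; simp
  have hm {i : ℕ} (hi : i ∈ Finset.range (m + 1)) : i + (m - i) = m := by
    have := Finset.mem_range.1 hi
    omega
  rw [h]
  constructor
  · refine mul_le_mul_of_nonneg_right ?_ hsub
    calc (m + 1) * a ^ m = ∑ i ∈ Finset.range (m + 1), a ^ m := by simp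
      _ ≤ _ := Finset.sum_le_sum fun i hi => by
        conv_lhs => rw [← hm hi, pow_add]
        gcongr
  · refine mul_le_mul_of_nonneg_right ?_ hsub
    calc _ ≤ ∑ i ∈ Finset.range (m + 1), b ^ m := Finset.sum_le_sum fun i hi => by
          conv_rhs => rw [← hm hi, pow_add]
          gcongr
      _ = _ := by simp

section IntegerVectors

variable {ι : Type*} [Fintype ι]

theorem norm_le_natCast_iff_mem_Icc [DecidableEq ι] (q : ι → ℤ) (k : ℕ) :
    ‖q‖ ≤ k ↔ q ∈ Finset.Icc (-k : ι → ℤ) k := by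
  rw [pi_norm_le_iff_of_nonneg (by positivity)]
  simp only [Finset.mem_Icc, Pi.le_def, ← forall_and, Int.norm_eq_abs]
  refine forall_congr' fun i => ?_
  simp only [Pi.neg_apply, Pi.natCast_apply, ← abs_le]
  norm_cast

theorem card_Icc_neg_natCast [DecidableEq ι] (k : ℕ) :
    (Finset.Icc (-k : ι → ℤ) k).card = (2 * k + 1) ^ Fintype.card ι := by
  rw [Pi.card_Icc]
  simp only [Pi.neg_apply, Pi.natCast_apply, Int.card_Icc, Finset.prod_const, Finset.card_univ]
  congr 1
  omega

theorem exists_natCast_eq_norm (q : ι → ℤ) : ∃ k : ℕ, ‖q‖ = k := by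
  refine ⟨⌊‖q‖⌋₊, le_antisymm ((pi_norm_le_iff_of_nonneg (by positivity)).2 fun i => ?_)
    (Nat.floor_le (norm_nonneg q))⟩
  have h : ((q i).natAbs : ℝ) = ‖q i‖ := by
    rw [Int.norm_eq_abs, Nat.cast_natAbs, Int.cast_abs]
  rw [← h]
  exact_mod_cast Nat.le_floor (h.trans_le (norm_le_pi_norm q i))

theorem setOf_norm_eq_succ [DecidableEq ι] (k : ℕ) :
    {q : ι → ℤ | ‖q‖ = (k + 1 : ℕ)} = Finset.box (α := ι → ℤ) (k + 1) := by
  ext q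
  obtain ⟨m, hm⟩ := exists_natCast_eq_norm q
  rw [Finset.box_succ_eq_sdiff, Finset.coe_sdiff, Set.mem_sdiff, Finset.mem_coe, Finset.mem_coe,
    ← norm_le_natCast_iff_mem_Icc, ← norm_le_natCast_iff_mem_Icc, Set.mem_ofPred_eq, hm]
  simp only [Nat.cast_le, Nat.cast_inj]
  omega

theorem finite_setOf_norm_eq (k : ℕ) : {q : ι → ℤ | ‖q‖ = k}.Finite := by
  classical
  exact (Finset.finite_toSet (Finset.Icc (-k : ι → ℤ) k)).subset fun q hq =>
    (norm_le_natCast_iff_mem_Icc q k).1 (le_of_eq hq)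

/-- The number of integer vectors of sup norm `k + 1`. -/
theorem card_setOf_norm_eq_succ (k : ℕ) :
    (Nat.card {q : ι → ℤ | ‖q‖ = (k + 1 : ℕ)} : ℝ) =
      (2 * k + 3) ^ Fintype.card ι - (2 * k + 1) ^ Fintype.card ι := by
  classical
  rw [setOf_norm_eq_succ, Nat.card_coe_set_eq, Set.ncard_coe_finset, eq_sub_iff_add_eq]
  have h := congrArg Finset.card (Finset.box_succ_disjUnion (α := ι → ℤ) k)
  rw [Finset.card_disjUnion, card_Icc_neg_natCast, card_Icc_neg_natCast] at h
  have h' := congrArg (Nat.cast (R := ℝ)) h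
  push_cast at h'
  rw [h']
  ring

/-- Summation over spheres: a radial function on nonzero integer vectors is summable iff the
sum of its values weighted by the sizes of the spheres converges. -/
theorem summable_radial_iff [Nonempty ι] {g : ℝ → ℝ} (hg : ∀ x, 0 ≤ x → 0 ≤ g x) :
    (Summable fun q : {q : ι → ℤ // q ≠ 0} => g ‖q.1‖) ↔
      Summable fun k : ℕ =>
        ((2 * k + 3 : ℝ) ^ Fintype.card ι - (2 * k + 1) ^ Fintype.card ι) * g (k + 1) := by
  have hzero := (Set.finite_singleton (0 : ι → ℤ)).summable_compl_iff
    (f := fun q : ι → ℤ => g ‖q‖)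
  refine hzero.trans ?_
  have hpart : ∀ q : ι → ℤ, ∃! k : ℕ, q ∈ {q : ι → ℤ | ‖q‖ = k} := fun q => by
    obtain ⟨k, hk⟩ := exists_natCast_eq_norm q
    exact ⟨k, hk, fun m hm => Nat.cast_injective (R := ℝ) (hm.symm.trans hk)⟩
  rw [summable_partition (fun q => hg _ (norm_nonneg q)) hpart, and_iff_right,
    ← summable_nat_add_iff 1]
  · refine summable_congr fun k => ?_
    rw [tsum_congr (g := fun _ => g (k + 1 : ℕ)) fun q => congrArg g q.2, tsum_const,
      nsmul_eq_mul, card_setOf_norm_eq_succ, Nat.cast_succ]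
  · intro k
    have := (finite_setOf_norm_eq (ι := ι) k).to_subtype
    exact Summable.of_finite

end IntegerVectors

/-- Schlömilch condensation along the powers `(k + 1) ^ (m + 1)`. -/
theorem summable_pow_condensed_iff (m : ℕ) {f : ℕ → ℝ} (hf : Antitone f) (hnn : ∀ k, 0 ≤ f k) :
    (Summable fun k : ℕ =>
        ((k + 2 : ℝ) ^ (m + 1) - (k + 1) ^ (m + 1)) * f ((k + 1) ^ (m + 1))) ↔ Summable f := by
  have hmono : StrictMono fun k : ℕ => (k + 1) ^ (m + 1) := fun a b hab =>
    Nat.pow_lt_pow_left (Nat.succ_lt_succ hab) m.succ_ne_zero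
  have hdiff : SuccDiffBounded (3 ^ m) fun k : ℕ => (k + 1) ^ (m + 1) := by
    intro k
    have h₁ := (pow_succ_sub_pow_succ_bounds m (a := k + 2) (b := k + 3)
      (by positivity) (by linarith)).2
    have h₂ := (pow_succ_sub_pow_succ_bounds m (a := k + 1) (b := k + 2)
      (by positivity) (by linarith)).1
    have h₃ : (k + 3 : ℝ) ^ m ≤ 3 ^ m * (k + 1) ^ m := by
      rw [← mul_pow]
      gcongr
      linarith
    have h : (k + 3 : ℝ) ^ (m + 1) - (k + 2) ^ (m + 1) ≤
        3 ^ m * ((k + 2) ^ (m + 1) - (k + 1) ^ (m + 1)) := by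
      calc _ ≤ (m + 1) * (k + 3 : ℝ) ^ m := by linarith
        _ ≤ (m + 1) * (3 ^ m * (k + 1) ^ m) := by gcongr
        _ = 3 ^ m * ((m + 1) * (k + 1) ^ m) := by ring
        _ ≤ _ := by
          gcongr
          linarith
    rw [smul_eq_mul, ← Nat.cast_le (α := ℝ), Nat.cast_mul,
      Nat.cast_sub (hmono (by omega)).le, Nat.cast_sub (hmono (by omega)).le]
    push_cast
    rwa [show (k + 2 + 1 : ℝ) = k + 3 by ring, show (k + 1 + 1 : ℝ) = k + 2 by ring]
  rw [← summable_schlomilch_iff_of_nonneg hnn (fun _ _ _ h => hf h)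
    (fun k => by positivity) hmono (by positivity) hdiff]
  refine summable_congr fun k => ?_
  push_cast
  ring_nf

/-- The convergence condition `Σ_k ψ(k) < ∞` is equivalent to
`Σ_{q ∈ ℤ^n∖{0}} ψ(‖q‖^n) < ∞` for a non-increasing `ψ : [0,∞) → [0,∞)`. -/
theorem summable_iff_summable_lattice (n : ℕ) (hn : 1 ≤ n) (ψ : ℝ → ℝ)
    (hmono : AntitoneOn ψ (Ici 0)) (hnn : ∀ x ∈ Ici (0 : ℝ), 0 ≤ ψ x) :
    (Summable fun k : ℕ => ψ (k + 1)) ↔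
      Summable fun q : {q : Fin n → ℤ // q ≠ 0} => ψ (‖q.1‖ ^ n) := by
  obtain ⟨m, rfl⟩ : ∃ m, n = m + 1 := ⟨n - 1, by omega⟩
  have hlattice := summable_radial_iff (ι := Fin (m + 1)) (g := fun x => ψ (x ^ (m + 1)))
    fun x hx => hnn _ (pow_nonneg hx _)
  have hseries := summable_pow_condensed_iff m (f := fun k : ℕ => ψ k)
    (fun a b hab => hmono (mem_Ici.2 (Nat.cast_nonneg a)) (mem_Ici.2 (Nat.cast_nonneg b))
      (Nat.cast_le.2 hab))
    (fun k => hnn _ (mem_Ici.2 (Nat.cast_nonneg k)))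
  rw [← summable_nat_add_iff (f := fun k : ℕ => ψ k) 1] at hseries
  simp only [Nat.cast_add, Nat.cast_one, Nat.cast_pow] at hseries
  rw [hlattice, ← hseries, Fintype.card_fin]
  have hψ (k : ℕ) : 0 ≤ ψ ((k + 1) ^ (m + 1)) := hnn _ (mem_Ici.2 (by positivity))
  have hsphere (k : ℕ) := pow_succ_sub_pow_succ_bounds m (a := 2 * k + 1) (b := 2 * k + 3)
    (by positivity) (by linarith)
  have hstep (k : ℕ) := pow_succ_sub_pow_succ_bounds m (a := k + 1) (b := k + 2)
    (by positivity) (by linarith)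
  constructor
  · intro h
    refine Summable.of_nonneg_of_le (fun k => mul_nonneg (sub_nonneg.2 ?_) (hψ k)) (fun k => ?_)
      (h.mul_left (2 * 3 ^ m))
    · gcongr
      norm_num
    · rw [← mul_assoc]
      refine mul_le_mul_of_nonneg_right ?_ (hψ k)
      have hpow : (2 * k + 3 : ℝ) ^ m ≤ 3 ^ m * (k + 1) ^ m := by
        rw [← mul_pow]
        gcongr
        linarith
      calc _ ≤ 2 * ((m + 1) * (2 * k + 3 : ℝ) ^ m) := by linarith [(hsphere k).2]
        _ ≤ 2 * ((m + 1) * (3 ^ m * (k + 1) ^ m)) := by gcongr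
        _ = 2 * 3 ^ m * ((m + 1) * (k + 1) ^ m) := by ring
        _ ≤ _ := by
          gcongr
          linarith [(hstep k).1]
  · intro h
    refine Summable.of_nonneg_of_le (fun k => mul_nonneg (sub_nonneg.2 ?_) (hψ k)) (fun k => ?_)
      (h.mul_left (2 ^ m))
    · gcongr
      norm_num
    · rw [← mul_assoc]
      refine mul_le_mul_of_nonneg_right ?_ (hψ k)
      have hpow : (k + 2 : ℝ) ^ m ≤ 2 ^ m * (2 * k + 1) ^ m := by
        rw [← mul_pow]
        gcongr
        linarith
      have hnonneg : 0 ≤ (m + 1) * (2 * k + 1 : ℝ) ^ m := by positivity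
      calc _ ≤ (m + 1) * (k + 2 : ℝ) ^ m := by linarith [(hstep k).2]
        _ ≤ (m + 1) * (2 ^ m * (2 * k + 1) ^ m) := by gcongr
        _ = 2 ^ m * ((m + 1) * (2 * k + 1) ^ m) := by ring
        _ ≤ _ := by
          gcongr
          linarith [(hsphere k).1]

end
end

section
/- Let 1 ≤ s < n and A ∈ Mat_{(s+1)×(n−s)}(ℝ) with ω_j(A) < n for every j = 1, …, n−s. Let ψ : [0,∞) → [0,∞) be non-increasing with Σ_{q ∈ ℤ^n∖{0}} ψ(‖q‖^n) < ∞. Then for any open ball U ⊂ ℝ^s, the set of x ∈ U for which there exist infinitely many q ∈ ℤ^n such that |(x, x̃A)·q + p| < ψ(‖q‖^n) for some p ∈ ℤ has Lebesgue measure zero. -/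
open MeasureTheory Metric Set
open scoped BigOperators ENNReal

noncomputable section

/-- If `X` has maximal determinant (up to replacing a row by an element of `S`), then `S` has at
most `3 ^ j * |det X|` elements. -/
lemma card_le_three_pow_mul_det {j : ℕ} (S : Finset (Fin j → ℤ)) (X : Matrix (Fin j) (Fin j) ℤ)
    (hX : X.det ≠ 0) (hmax : ∀ y ∈ S, ∀ i, |(X.updateRow i y).det| ≤ |X.det|) :
    S.card ≤ 3 ^ j * X.det.natAbs := by
  classical
  set L : (Fin j → ℤ) →ₗ[ℤ] (Fin j → ℤ) := Matrix.toLin' X.transpose with hL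
  have hcr : ∀ y, L (X.transpose.cramer y) = X.det • y := fun y => by
    rw [hL, Matrix.toLin'_apply, Matrix.mulVec_cramer, Matrix.det_transpose]
  have hinj : Function.Injective L := by
    rw [hL]
    have h := Matrix.mulVec_injective_of_det_ne_zero (M := X.transpose)
      (by rwa [Matrix.det_transpose])
    intro a b hab
    exact h (by simpa [Matrix.toLin'_apply] using hab)
  set N := LinearMap.range L with hN
  have hcard : Nat.card ((Fin j → ℤ) ⧸ N) = X.det.natAbs := by
    rw [← Submodule.natAbs_det_equiv N (LinearEquiv.ofInjective L hinj)]
    have : N.subtype ∘ₗ (((LinearEquiv.ofInjective L hinj :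
        (Fin j → ℤ) ≃ₗ[ℤ] N) : (Fin j → ℤ) →+ N).toIntLinearMap) = L := by
      ext v; rfl
    rw [this, hL, LinearMap.det_toLin', Matrix.det_transpose]
  have hfin : Finite ((Fin j → ℤ) ⧸ N) := by
    apply Nat.finite_of_card_ne_zero
    rw [hcard]; simpa using hX
  have := Fintype.ofFinite ((Fin j → ℤ) ⧸ N)
  set f : (Fin j → ℤ) → ((Fin j → ℤ) ⧸ N) × (Fin j → ℤ) := fun y =>
    (Submodule.Quotient.mk y, fun i => X.transpose.cramer y i / X.det) with hf
  have hmaps : Set.MapsTo f S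
      ((Finset.univ ×ˢ Fintype.piFinset fun _ : Fin j => Finset.Icc (-1 : ℤ) 1 :
        Finset (((Fin j → ℤ) ⧸ N) × (Fin j → ℤ))) : Set _) := by
    intro y hy
    simp only [Finset.mem_coe, Finset.mem_product, Finset.mem_univ, true_and, Fintype.mem_piFinset,
      Finset.mem_Icc, hf]
    intro i
    have h := hmax y hy i
    rw [← Matrix.cramer_transpose_apply] at h
    generalize X.transpose.cramer y i = a at h
    have h1 := Int.emod_add_mul_ediv a X.det
    have h2 := Int.emod_nonneg a hX
    have h3 := Int.emod_lt_abs a hX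
    have h4 := abs_le.1 h
    have h5 : 0 < |X.det| := abs_pos.2 hX
    rcases abs_cases X.det with ⟨h6, h7⟩ | ⟨h6, h7⟩ <;> rw [h6] at h3 h4 h5 <;>
      constructor <;> by_contra! hc <;> nlinarith
  have hinjOn : Set.InjOn f S := by
    intro y _ y' _ hyy
    simp only [hf, Prod.mk.injEq] at hyy
    obtain ⟨hq, hd⟩ := hyy
    rw [Submodule.Quotient.eq] at hq
    obtain ⟨v, hv⟩ := hq
    have hv0 : X.transpose.cramer y - X.transpose.cramer y' = X.det • v := by
      apply hinj
      rw [map_sub, hcr, hcr, map_smul, hv, smul_sub]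
    have hz : v = 0 := by
      ext i
      have e1 := congrFun hv0 i
      have e2 := congrFun hd i
      simp only [Pi.sub_apply, Pi.smul_apply, smul_eq_mul] at e1 e2
      have h1 := Int.emod_add_mul_ediv (X.transpose.cramer y i) X.det
      have h1' := Int.emod_add_mul_ediv (X.transpose.cramer y' i) X.det
      have h2 := Int.emod_nonneg (X.transpose.cramer y i) hX
      have h2' := Int.emod_nonneg (X.transpose.cramer y' i) hX
      have h3 := Int.emod_lt_abs (X.transpose.cramer y i) hX
      have h3' := Int.emod_lt_abs (X.transpose.cramer y' i) hX
      rw [e2] at h1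
      have h6 : |X.det * v i| < |X.det| * 1 := by
        rw [abs_lt]; constructor <;> linarith
      rw [abs_mul] at h6
      have := lt_of_mul_lt_mul_left h6 (abs_nonneg _)
      simpa using Int.abs_lt_one_iff.1 this
    rw [hz, map_zero] at hv
    exact (sub_eq_zero.1 hv.symm)
  calc S.card ≤ _ := Finset.card_le_card_of_injOn f hmaps hinjOn
    _ = 3 ^ j * X.det.natAbs := by
      rw [Finset.card_product, Finset.card_univ, Fintype.card_eq_nat_card, hcard,
        Fintype.card_piFinset]
      simp [mul_comm]

/-- A finite set of integer vectors is contained in the span of a linearly independent family `b`,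
and contains vectors `X * b` such that `|det X|` controls the cardinality of the set. -/
lemma exists_basis_det_ge_card {ι : Type*} [Finite ι] (S : Finset (ι → ℤ)) :
    ∃ (j : ℕ) (b : Fin j → ι → ℤ) (X : Matrix (Fin j) (Fin j) ℤ), LinearIndependent ℤ b ∧
      X.det ≠ 0 ∧ (∀ i, ∑ k, X i k • b k ∈ S) ∧ S.card ≤ 3 ^ j * X.det.natAbs := by
  classical
  set Γ := Submodule.span ℤ (S : Set (ι → ℤ)) with hΓ
  obtain ⟨j, ⟨B⟩⟩ := Submodule.nonempty_basis_of_pid (Pi.basisFun ℤ ι) Γ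
  have hmem : ∀ y ∈ S, y ∈ Γ := fun y hy => Submodule.subset_span hy
  set g : S → (Fin j → ℤ) := fun y => B.equivFun ⟨y.1, hmem _ y.2⟩ with hg
  have hsum : ∀ y : S, ∑ k, g y k • (B k : ι → ℤ) = y.1 := by
    intro y
    have h := congrArg Subtype.val (B.sum_equivFun ⟨y.1, hmem _ y.2⟩)
    rw [← h, Submodule.coe_sum]
    rfl
  have hginj : Function.Injective g := by
    intro y y' h
    apply Subtype.ext
    rw [← hsum y, ← hsum y', h]
  have hspan : Submodule.span ℤ (Set.range g) = ⊤ := by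
    have h1 : Submodule.span ℤ (Set.range fun y : S => (⟨y.1, hmem _ y.2⟩ : Γ)) = ⊤ := by
      have h2 := Submodule.span_span_coe_preimage (R := ℤ) (s := (S : Set (ι → ℤ)))
      rw [← h2]
      congr 1
      ext ⟨v, hv⟩
      simp
    have h3 : Set.range g = B.equivFun '' (Set.range fun y : S => (⟨y.1, hmem _ y.2⟩ : Γ)) := by
      rw [← Set.range_comp]; rfl
    rw [h3]
    change Submodule.span ℤ ((B.equivFun : Γ →ₗ[ℤ] (Fin j → ℤ)) '' _) = ⊤
    rw [Submodule.span_image, h1, Submodule.map_top]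
    exact LinearMap.range_eq_top.2 B.equivFun.surjective
  -- some choice of rows has nonzero determinant
  have hex : ∃ φ : Fin j → S, (Matrix.of fun i => g (φ i)).det ≠ 0 := by
    by_contra! hcon
    have hc : ∀ i : Fin j, ∃ c : S → ℤ, ∑ y, c y • g y = Pi.single i 1 := fun i =>
      (Submodule.mem_span_range_iff_exists_fun ℤ).1 (by rw [hspan]; trivial)
    choose c hc using hc
    have h1 : Matrix.detRowAlternating (fun i : Fin j => ∑ y, c i y • g y) = (1 : ℤ) := by
      simp only [hc]
      refine Eq.trans ?_ (Matrix.det_one (n := Fin j) (R := ℤ))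
      change Matrix.det (fun i : Fin j => Pi.single i (1 : ℤ)) = _
      congr 1
      ext a b
      simp [Matrix.one_apply, Pi.single_apply, eq_comm]
    rw [← AlternatingMap.coe_multilinearMap, MultilinearMap.map_sum] at h1
    rw [Finset.sum_eq_zero] at h1
    · exact zero_ne_one h1
    intro φ _
    rw [MultilinearMap.map_smul_univ]
    have h2 := hcon φ
    change Matrix.detRowAlternating (fun i => g (φ i)) = 0 at h2
    rw [AlternatingMap.coe_multilinearMap, h2, smul_zero]
  have : Nonempty (Fin j → S) := ⟨hex.choose⟩
  obtain ⟨φ, hφ⟩ := Finite.exists_max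
    (fun φ : Fin j → S => |(Matrix.of fun i => g (φ i)).det|)
  refine ⟨j, fun k => (B k : ι → ℤ), Matrix.of fun i => g (φ i), ?_, ?_, ?_, ?_⟩
  · exact B.linearIndependent.map' Γ.subtype (Submodule.ker_subtype Γ)
  · obtain ⟨φ', h'⟩ := hex
    intro h0
    have := hφ φ'
    rw [h0, abs_zero] at this
    exact h' (abs_eq_zero.1 (le_antisymm this (abs_nonneg _)))
  · intro i
    simp only [Matrix.of_apply]
    rw [hsum]
    exact (φ i).2
  · have hc : S.card = (Finset.univ.image g).card := by
      rw [Finset.card_image_of_injective _ hginj]; simp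
    rw [hc]
    apply card_le_three_pow_mul_det
    · obtain ⟨φ', h'⟩ := hex
      intro h0
      have := hφ φ'
      rw [h0, abs_zero] at this
      exact h' (abs_eq_zero.1 (le_antisymm this (abs_nonneg _)))
    · intro y hy i
      obtain ⟨y, -, rfl⟩ := Finset.mem_image.1 hy
      refine le_trans (le_of_eq ?_) (hφ (Function.update φ i y))
      congr 2
      ext a k
      by_cases h : a = i
      · subst h; simp
      · simp [Matrix.updateRow_ne h, Function.update_of_ne h]

lemma abs_det_le_factorial_mul_prod {n : ℕ} (M : Matrix (Fin n) (Fin n) ℝ) (β : Fin n → ℝ)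
    (h : ∀ a i, |M a i| ≤ β i) : |M.det| ≤ n.factorial * ∏ i, β i := by
  rw [Matrix.det_apply]
  refine (Finset.abs_sum_le_sum_abs _ _).trans ?_
  have h1 : ∀ σ ∈ (Finset.univ : Finset (Equiv.Perm (Fin n))),
      |Equiv.Perm.sign σ • ∏ i, M (σ i) i| ≤ ∏ i, β i := by
    intro σ _
    rw [Units.smul_def, zsmul_eq_mul, abs_mul, Finset.abs_prod]
    have h2 : |((Equiv.Perm.sign σ : ℤ) : ℝ)| = 1 := by
      rcases Int.units_eq_one_or (Equiv.Perm.sign σ) with h | h <;> simp [h]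
    rw [h2, one_mul]
    exact Finset.prod_le_prod (fun _ _ => abs_nonneg _) fun i _ => h _ _
  refine (Finset.sum_le_card_nsmul _ _ _ h1).trans (le_of_eq ?_)
  rw [Finset.card_univ, Fintype.card_perm, Fintype.card_fin, nsmul_eq_mul]

lemma cMap_wedgeOf {n k : ℕ} (v : Fin (k + 1) → Fin (n + 1) → ℝ) (J : Finset (Fin (n + 1)))
    (h0 : (0 : Fin (n + 1)) ∉ J) (hJ : J.card = k) (i : Fin (n + 1)) :
    cMap (wedgeOf v) i J = ∑ l : Fin (k + 1), (-1 : ℝ) ^ (l : ℕ) * v l i *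
      (Matrix.of fun p q : Fin k => v (l.succAbove p) (J.orderEmbOfFin hJ q)).det := by
  by_cases hi : i ∈ J
  · rw [cMap, if_pos (Or.inr hi)]
    obtain ⟨q, hq⟩ : ∃ q, J.orderEmbOfFin hJ q = i := by
      have := Finset.range_orderEmbOfFin J hJ
      exact (this.symm ▸ hi : i ∈ Set.range (J.orderEmbOfFin hJ))
    set M : Matrix (Fin (k + 1)) (Fin (k + 1)) ℝ := Matrix.of fun l c =>
      (Fin.cons (v l i) (fun q => v l (J.orderEmbOfFin hJ q)) : Fin (k + 1) → ℝ) c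
    have hM : M.det = 0 := Matrix.det_zero_of_column_eq (i := 0) (j := q.succ)
      (Fin.succ_ne_zero q).symm fun l => by simp [M, hq]
    rw [← hM, Matrix.det_succ_column M 0]
    refine Finset.sum_congr rfl fun l _ => ?_
    simp [M, Matrix.submatrix]
  · rw [cMap, if_neg (by tauto)]
    have hc : (insert i J).card = k + 1 := by rw [Finset.card_insert_of_notMem hi, hJ]
    rw [wedgeOf, dif_pos hc]
    obtain ⟨q, hq⟩ : ∃ q, (insert i J).orderEmbOfFin hc q = i := by
      have := Finset.range_orderEmbOfFin (insert i J) hc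
      exact (this.symm ▸ (by simp) : i ∈ Set.range ((insert i J).orderEmbOfFin hc))
    have hsub : ∀ p, (insert i J).orderEmbOfFin hc (q.succAbove p) = J.orderEmbOfFin hJ p := by
      have := Finset.orderEmbOfFin_unique hJ
        (f := fun p => (insert i J).orderEmbOfFin hc (q.succAbove p)) (fun p => by
          have h1 := Finset.orderEmbOfFin_mem (insert i J) hc (q.succAbove p)
          rcases Finset.mem_insert.1 h1 with h2 | h2
          · exact absurd ((insert i J).orderEmbOfFin hc |>.injective (h2.trans hq.symm))
              (Fin.succAbove_ne q p)
          · exact h2)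
        (((insert i J).orderEmbOfFin hc).strictMono.comp (Fin.strictMono_succAbove q))
      exact fun p => congrFun this p
    have hpos : (J.filter (· < i)).card = (q : ℕ) := by
      have : J.filter (· < i) = (Finset.univ.filter (· < q)).map
          ((insert i J).orderEmbOfFin hc).toEmbedding := by
        ext x
        simp only [Finset.mem_filter, Finset.mem_map, Finset.mem_univ, true_and]
        constructor
        · rintro ⟨hx, hxi⟩
          obtain ⟨p, hp⟩ : ∃ p, (insert i J).orderEmbOfFin hc p = x := by
            have := Finset.range_orderEmbOfFin (insert i J) hc
            exact (this.symm ▸ (by simp [hx]) : x ∈ Set.range ((insert i J).orderEmbOfFin hc))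
          refine ⟨p, ?_, hp⟩
          rw [← hp] at hxi
          exact ((insert i J).orderEmbOfFin hc).lt_iff_lt.1 (hxi.trans_eq hq.symm)
        · rintro ⟨p, hp, rfl⟩
          have h1 : (insert i J).orderEmbOfFin hc p < i := by
            conv_rhs => rw [← hq]
            exact ((insert i J).orderEmbOfFin hc).lt_iff_lt.2 hp
          refine ⟨?_, h1⟩
          rcases Finset.mem_insert.1 (Finset.orderEmbOfFin_mem (insert i J) hc p) with h2 | h2
          · exact absurd h2 h1.ne
          · exact h2
      rw [this, Finset.card_map, Finset.filter_gt_eq_Iio, Fin.card_Iio]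
    rw [hpos, Matrix.det_succ_column _ q, Finset.mul_sum]
    refine Finset.sum_congr rfl fun l _ => ?_
    have e : (Matrix.of fun a b => v a ((insert i J).orderEmbOfFin hc b)).submatrix l.succAbove
        q.succAbove = Matrix.of fun p q : Fin k => v (l.succAbove p) (J.orderEmbOfFin hJ q) := by
      ext a b
      simp [hsub]
    rw [e, Matrix.of_apply, hq, pow_add]
    have : (-1 : ℝ) ^ (q : ℕ) * (-1 : ℝ) ^ (q : ℕ) = 1 := by
      rw [← mul_pow]; simp
    linear_combination ((-1 : ℝ) ^ (l : ℕ) * v l i * (Matrix.of fun p q : Fin k =>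
      v (l.succAbove p) (J.orderEmbOfFin hJ q)).det) * this

/-- Contraction of a decomposable multivector against a row of `R_A`. -/
lemma abs_RAc_wedgeOf_le {s m k : ℕ} (A : Matrix (Fin (s + 1)) (Fin m) ℝ)
    (v : Fin (k + 1) → Fin (s + m + 1) → ℝ) {ρ T : ℝ}
    (hρ : ∀ l a, |∑ i, RA A a i * v l i| ≤ ρ) (hT : ∀ l i, |v l i| ≤ T)
    (a : Fin (s + 1)) (J : Finset (Fin (s + m + 1))) :
    |RAc A (wedgeOf v) a J| ≤ (k + 1).factorial * (ρ * T ^ k) := by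
  have hρ0 : 0 ≤ ρ := (abs_nonneg _).trans (hρ 0 a)
  have hT0 : 0 ≤ T := (abs_nonneg _).trans (hT 0 0)
  by_cases h0 : (0 : Fin (s + m + 1)) ∈ J
  · have : RAc A (wedgeOf v) a J = 0 :=
      Finset.sum_eq_zero fun i _ => by rw [cMap, if_pos (Or.inl h0), mul_zero]
    rw [this, abs_zero]; positivity
  by_cases hJ : J.card = k
  · have h1 : RAc A (wedgeOf v) a J = ∑ l : Fin (k + 1), (-1 : ℝ) ^ (l : ℕ) *
        (∑ i, RA A a i * v l i) *
        (Matrix.of fun p q : Fin k => v (l.succAbove p) (J.orderEmbOfFin hJ q)).det := by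
      simp only [RAc, cMap_wedgeOf v J h0 hJ, Finset.mul_sum, Finset.sum_mul]
      rw [Finset.sum_comm]
      exact Finset.sum_congr rfl fun l _ => Finset.sum_congr rfl fun i _ => by ring
    rw [h1]
    refine (Finset.abs_sum_le_sum_abs _ _).trans ?_
    refine (Finset.sum_le_card_nsmul _ _ (ρ * (k.factorial * T ^ k)) fun l _ => ?_).trans
      (le_of_eq ?_)
    · rw [abs_mul, abs_mul, abs_pow, abs_neg, abs_one, one_pow, one_mul]
      refine mul_le_mul (hρ l a) ?_ (abs_nonneg _) hρ0
      refine (abs_det_le_factorial_mul_prod _ (fun _ => T) fun _ _ => hT _ _).trans (le_of_eq ?_)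
      simp
    · rw [Finset.card_univ, Fintype.card_fin, nsmul_eq_mul, Nat.factorial_succ]
      push_cast; ring
  · have : RAc A (wedgeOf v) a J = 0 := Finset.sum_eq_zero fun i _ => by
      rw [cMap]
      split_ifs with h
      · simp
      · have hc : (insert i J).card ≠ k + 1 := by
          rw [Finset.card_insert_of_notMem (by tauto)]; omega
        rw [wedgeOf, dif_neg hc]; simp
    rw [this, abs_zero]; positivity

/-- The `i`-th coordinate of `z` in the coordinate system obtained by replacing the first `s + 1`
coordinates by the rows of `R_A`. -/
def mixedCoord {s m : ℕ} (A : Matrix (Fin (s + 1)) (Fin m) ℝ) (z : Fin (s + m + 1) → ℝ)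
    (i : Fin (s + m + 1)) : ℝ :=
  if h : s < (i : ℕ) then z i else ∑ k, RA A ⟨i, by omega⟩ k * z k

lemma sum_RA_mul {s m : ℕ} (A : Matrix (Fin (s + 1)) (Fin m) ℝ) (z : Fin (s + m + 1) → ℝ)
    (i : Fin (s + m + 1)) (h : ¬ s < (i : ℕ)) :
    ∑ k, RA A ⟨i, by omega⟩ k * z k =
      z i + ∑ k ∈ Finset.univ.filter (fun k : Fin (s + m + 1) => s < (k : ℕ)),
        RA A ⟨i, by omega⟩ k * z k := by
  rw [← Finset.sum_filter_not_add_sum_filter _ (fun k : Fin (s + m + 1) => s < (k : ℕ))]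
  congr 1
  rw [Finset.sum_eq_single i]
  · simp [RA, show (i : ℕ) < s + 1 by omega]
  · intro k hk hki
    have hk' : (k : ℕ) < s + 1 := by
      have := (Finset.mem_filter.1 hk).2; omega
    have : (k : ℕ) ≠ i := fun e => hki (Fin.ext e)
    simp [RA, hk', this]
  · intro hi
    exact absurd (by simpa using h) hi

/-- One can choose a nonzero maximal minor of an integer matrix of full row rank which is unchanged
under replacing the first `s + 1` coordinates by the rows of `R_A`. -/
lemma exists_minor_mixedCoord {s m j : ℕ} (A : Matrix (Fin (s + 1)) (Fin m) ℝ)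
    (b : Fin j → Fin (s + m + 1) → ℤ) (hb : LinearIndependent ℤ b) :
    ∃ (B : Finset (Fin (s + m + 1))) (hB : B.card = j),
      (Matrix.of fun a c => b a (B.orderEmbOfFin hB c)).det ≠ 0 ∧
      (Matrix.of fun a c => mixedCoord A (fun i => (b a i : ℝ)) (B.orderEmbOfFin hB c)).det =
        (Matrix.of fun a c => (b a (B.orderEmbOfFin hB c) : ℝ)).det := by
  classical
  set C : Fin (s + m + 1) → Fin j → ℚ := fun i a => b a i with hC
  set H : Set (Fin (s + m + 1)) := {i | s < (i : ℕ)} with hH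
  obtain ⟨J, hJH, -, hJspan, hJ⟩ := exists_linearIndepOn_extension (K := ℚ) (v := C)
    (linearIndepOn_empty ℚ C) (Set.empty_subset H)
  obtain ⟨B', -, hJB, hBspan, hB⟩ := exists_linearIndepOn_extension (K := ℚ) (v := C)
    hJ (Set.subset_univ J)
  set B : Finset (Fin (s + m + 1)) := B'.toFinset with hBdef
  have hbQ : LinearIndependent ℚ (fun a i => (b a i : ℚ)) := by
    rw [← LinearIndependent.iff_fractionRing ℤ ℚ]
    refine hb.map' ((Int.castAddHom ℚ).toIntLinearMap.compLeft (Fin (s + m + 1))) ?_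
    rw [LinearMap.ker_eq_bot]
    intro x y hxy
    ext i
    have := congrFun hxy i
    simpa using this
  have hrank : Module.finrank ℚ (Submodule.span ℚ (Set.range C)) = j := by
    have h1 := LinearIndependent.rank_matrix (M := Matrix.of fun a i => (b a i : ℚ)) hbQ
    rw [Matrix.rank_eq_finrank_span_cols, Fintype.card_fin] at h1
    exact h1
  have hcard : B.card = j := by
    have h1 : Submodule.span ℚ (Set.range C) = Submodule.span ℚ (C '' B') := by
      refine le_antisymm (Submodule.span_le.2 ?_) (Submodule.span_mono (Set.image_subset_range _ _))
      rw [← Set.image_univ]; exact hBspan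
    rw [h1, Set.image_eq_range] at hrank
    rw [finrank_span_eq_card (b := fun i : B' => C i) hB] at hrank
    rw [hBdef, Set.toFinset_card]; exact hrank
  refine ⟨B, hcard, ?_, ?_⟩
  · have h1 : LinearIndependent ℚ (fun c => C (B.orderEmbOfFin hcard c)) := by
      have := LinearIndependent.comp (hB : LinearIndependent ℚ fun i : B' => C i)
        (fun c => ⟨B.orderEmbOfFin hcard c, by
          exact Set.mem_toFinset.1 (Finset.orderEmbOfFin_mem B hcard c)⟩)
        (fun c c' h => (B.orderEmbOfFin hcard).injective (by
          have h' := congrArg Subtype.val h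
          exact h'))
      exact this
    have h2 : IsUnit (Matrix.of fun a c => (b a (B.orderEmbOfFin hcard c) : ℚ)) :=
      Matrix.linearIndependent_cols_iff_isUnit.1 h1
    rw [Matrix.isUnit_iff_isUnit_det, isUnit_iff_ne_zero] at h2
    intro h3
    apply h2
    have := congrArg (Int.cast : ℤ → ℚ) h3
    rw [Int.cast_det, Int.cast_zero] at this
    exact this
  · have hcoef : ∀ h : Fin (s + m + 1), s < (h : ℕ) → ∃ e : Fin j → ℚ,
        (∀ c, ¬ s < (B.orderEmbOfFin hcard c : ℕ) → e c = 0) ∧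
        ∑ c, e c • C (B.orderEmbOfFin hcard c) = C h := by
      intro h hh
      obtain ⟨l, hl, hlC⟩ := (Finsupp.mem_span_image_iff_linearCombination ℚ).1
        (hJspan ⟨h, hh, rfl⟩)
      rw [Finsupp.mem_supported] at hl
      refine ⟨fun c => l (B.orderEmbOfFin hcard c), fun c hc => ?_, ?_⟩
      · by_contra h0
        exact hc (hJH (hl (Finsupp.mem_support_iff.2 h0)))
      · rw [← hlC, Finsupp.linearCombination_apply, Finsupp.sum]
        have hsub : l.support ⊆ B := fun i hi => by
          rw [hBdef, Set.mem_toFinset]; exact hJB (hl hi)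
        rw [Finset.sum_subset hsub fun i _ hi => by
          rw [Finsupp.notMem_support_iff.1 hi, zero_smul]]
        have h3 : B = Finset.univ.map (B.orderEmbOfFin hcard).toEmbedding := by
          ext i
          simp
        conv_rhs => rw [h3]
        rw [Finset.sum_map]
        rfl
    choose! e he0 heC using hcoef
    set f := B.orderEmbOfFin hcard with hf
    set U : Matrix (Fin j) (Fin j) ℝ := Matrix.of fun c' c => (if c' = c then 1 else 0) +
      if h : s < (f c : ℕ) then 0 else
        ∑ k ∈ Finset.univ.filter (fun k : Fin (s + m + 1) => s < (k : ℕ)),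
          RA A ⟨f c, by omega⟩ k * (e k c' : ℝ) with hU
    have hUdet : U.det = 1 := by
      rw [Matrix.twoBlockTriangular_det U (fun c => s < (f c : ℕ))]
      · have h1 : U.toSquareBlockProp (fun c => s < (f c : ℕ)) = 1 := by
          ext ⟨a, ha⟩ ⟨c, hc⟩
          simp [U, Matrix.toSquareBlockProp, hc, Matrix.one_apply]
        have h2 : U.toSquareBlockProp (fun c => ¬ s < (f c : ℕ)) = 1 := by
          ext ⟨a, ha⟩ ⟨c, hc⟩
          have : ∀ k ∈ Finset.univ.filter (fun k : Fin (s + m + 1) => s < (k : ℕ)),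
              RA A ⟨f c, by omega⟩ k * (e k a : ℝ) = 0 := fun k hk => by
            rw [he0 k (Finset.mem_filter.1 hk).2 a ha, Rat.cast_zero, mul_zero]
          change U a c = _
          simp only [U, Matrix.of_apply, dif_neg hc,
            Finset.sum_eq_zero this, add_zero, Matrix.one_apply, Subtype.mk.injEq]
        rw [h1, h2, Matrix.det_one, Matrix.det_one, mul_one]
      · intro a ha c hc
        have : a ≠ c := fun h => ha (h ▸ hc)
        simp [U, hc, this]
    have hmul : (Matrix.of fun a c => mixedCoord A (fun i => (b a i : ℝ)) (f c)) =
        (Matrix.of fun a c => (b a (f c) : ℝ)) * U := by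
      ext a c
      rw [Matrix.mul_apply]
      simp only [Matrix.of_apply, U, mul_add, Finset.sum_add_distrib, mul_ite, mul_one, mul_zero,
        Finset.sum_ite_eq', Finset.mem_univ, if_true, mixedCoord]
      by_cases hc : s < (f c : ℕ)
      · simp [hc]
      · simp only [dif_neg hc]
        rw [sum_RA_mul A _ _ hc]
        congr 1
        simp only [Finset.mul_sum]
        rw [Finset.sum_comm]
        refine Finset.sum_congr rfl fun k hk => ?_
        have h1 := congrArg (Rat.cast : ℚ → ℝ)
          (congrFun (heC k (Finset.mem_filter.1 hk).2) a)
        simp only [Finset.sum_apply, Pi.smul_apply, smul_eq_mul, hC, Rat.cast_sum, Rat.cast_mul,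
          Rat.cast_intCast] at h1
        rw [← h1, Finset.mul_sum]
        exact Finset.sum_congr rfl fun c' _ => by ring
    rw [hmul, Matrix.det_mul, hUdet, mul_one]

lemma exists_exponent_notMem_expSet {s m : ℕ} (hs : 1 ≤ s)
    {A : Matrix (Fin (s + 1)) (Fin m) ℝ} (hA : DiophCond s m A) :
    ∃ v : ℝ, (m : ℝ) ≤ v ∧ v < (s + m : ℕ) ∧ ∀ j, 1 ≤ j → j ≤ m → v ∉ expSet s m A j := by
  have hind : ∀ M ≤ m, ∃ v : ℝ, (m : ℝ) ≤ v ∧ v < (s + m : ℕ) ∧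
      ∀ j, 1 ≤ j → j ≤ M → ∀ u ∈ expSet s m A j, u ≤ v := by
    intro M
    induction M with
    | zero =>
      intro _
      exact ⟨m, le_rfl, by exact_mod_cast (by omega : m < s + m), fun j h1 h2 => by omega⟩
    | succ M ih =>
      intro hM
      obtain ⟨v, hmv, hvn, hv⟩ := ih (by omega)
      obtain ⟨v', hv'n, hv'⟩ := hA (M + 1) (by omega) hM
      refine ⟨max v v', hmv.trans (le_max_left _ _), max_lt hvn hv'n, fun j h1 h2 u hu => ?_⟩
      rcases Nat.lt_or_ge M j with h | h
      · obtain rfl : j = M + 1 := by omega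
        exact (hv' u hu).trans (le_max_right _ _)
      · exact (hv j h1 h u hu).trans (le_max_left _ _)
  obtain ⟨v, hmv, hvn, hv⟩ := hind m le_rfl
  refine ⟨(v + (s + m : ℕ)) / 2, by linarith, by linarith, fun j h1 h2 h3 => ?_⟩
  have := hv j h1 h2 _ h3
  linarith

lemma pibullNorm_const_mul {s n : ℕ} (c : ℝ) (w : Finset (Fin (n + 1)) → ℝ) :
    pibullNorm s (fun S => c * w S) = |c| * pibullNorm s w := by
  rw [pibullNorm, pibullNorm, ← Real.sqrt_sq_eq_abs, ← Real.sqrt_mul (sq_nonneg c), Finset.mul_sum]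
  congr 1
  exact Finset.sum_congr rfl fun S _ => by split_ifs <;> ring

lemma RAcNorm_const_mul {s m : ℕ} (A : Matrix (Fin (s + 1)) (Fin m) ℝ) (c : ℝ)
    (w : Finset (Fin (s + m + 1)) → ℝ) :
    RAcNorm A (fun S => c * w S) = |c| * RAcNorm A w := by
  have h : ∀ a J, RAc A (fun S => c * w S) a J = c * RAc A w a J := fun a J => by
    rw [RAc, RAc, Finset.mul_sum]
    refine Finset.sum_congr rfl fun i _ => ?_
    rw [cMap, cMap]
    split_ifs <;> ring
  rw [RAcNorm, RAcNorm, ← Real.sqrt_sq_eq_abs, ← Real.sqrt_mul (sq_nonneg c)]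
  congr 1
  simp only [h, mul_pow, Finset.mul_sum]

lemma one_le_pibullNorm {s n : ℕ} (w : Finset (Fin (n + 1)) → ℤ) (S : Finset (Fin (n + 1)))
    (hS : ∀ i ∈ S, s < (i : ℕ)) (hw : w S ≠ 0) : 1 ≤ pibullNorm s (fun S => (w S : ℝ)) := by
  rw [pibullNorm, Real.one_le_sqrt]
  refine le_trans ?_ (Finset.single_le_sum (fun S _ => ?_) (Finset.mem_univ S))
  · rw [if_pos hS]
    have : 1 ≤ |w S| := Int.one_le_abs hw
    have h2 : 1 ≤ w S ^ 2 := by rw [← sq_abs]; nlinarith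
    exact_mod_cast h2
  · split_ifs <;> positivity

lemma sqrt_sum_le {ι : Type*} [Fintype ι] (g : ι → ℝ) {β : ℝ} (hβ : 0 ≤ β)
    (h : ∀ i, g i ≤ β ^ 2) : Real.sqrt (∑ i, g i) ≤ Fintype.card ι * β := by
  rw [Real.sqrt_le_left (by positivity)]
  refine (Finset.sum_le_card_nsmul _ _ _ fun i _ => h i).trans ?_
  rw [Finset.card_univ, nsmul_eq_mul, mul_pow]
  refine mul_le_mul_of_nonneg_right ?_ (sq_nonneg _)
  exact_mod_cast Nat.le_self_pow two_ne_zero _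

lemma exists_RAcNorm_ge {s m j : ℕ} (A : Matrix (Fin (s + 1)) (Fin m) ℝ) {v : ℝ} (hv0 : 0 < v)
    (hv : v ∉ expSet s m A j) : ∃ c : ℝ, 0 < c ∧ ∀ w : Finset (Fin (s + m + 1)) → ℤ,
      (∀ S, S.card ≠ j → w S = 0) → 1 ≤ pibullNorm s (fun S => (w S : ℝ)) →
      c * pibullNorm s (fun S => (w S : ℝ)) ^ (-(v + 1 - j) / j) ≤
        RAcNorm A (fun S => (w S : ℝ)) := by
  simp only [expSet, Set.mem_ofPred_eq, not_and, not_forall, not_exists, not_lt] at hv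
  obtain ⟨M, hM⟩ := hv hv0
  obtain ⟨k, hk⟩ := exists_nat_gt (max M 0)
  have hk0 : (0 : ℝ) < k := (le_max_right _ _).trans_lt hk
  refine ⟨(k : ℝ) ^ (-(v + 1 - j) / j : ℝ) / k, by positivity, fun w hw hQ => ?_⟩
  have e1 : (fun S => (((k : ℤ) * w S : ℤ) : ℝ)) = fun S => (k : ℝ) * (w S : ℝ) := by
    ext S; push_cast; rfl
  have h := hM (fun S => (k : ℤ) * w S) (fun S hS => by simp [hw S hS])
  rw [e1, pibullNorm_const_mul, RAcNorm_const_mul, abs_of_pos hk0] at h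
  have h1 := h (((le_max_left _ _).trans_lt hk).trans_le (le_mul_of_one_le_right hk0.le hQ))
  rw [Real.mul_rpow hk0.le (by linarith)] at h1
  rw [div_mul_eq_mul_div, div_le_iff₀ hk0, mul_comm (RAcNorm A _)]
  exact h1

lemma wedgeOf_mul {N j : ℕ} (X : Matrix (Fin j) (Fin j) ℝ) (b : Fin j → Fin N → ℝ) :
    wedgeOf (fun a i => ∑ k, X a k * b k i) = fun S => X.det * wedgeOf b S := by
  ext S
  rw [wedgeOf, wedgeOf]
  split_ifs with h
  · rw [← Matrix.det_mul]
    congr 1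
  · simp

/-- The bound for the index of a family of integer vectors close to the kernel of `R_A`, when the
vectors have independent projections to the last `m` coordinates. -/
lemma exists_det_le_of_notMem_expSet {s m j : ℕ} (hj : 1 ≤ j) (hjm : j ≤ m)
    (A : Matrix (Fin (s + 1)) (Fin m) ℝ) {v : ℝ} (hmv : (m : ℝ) ≤ v)
    (hv : v ∉ expSet s m A j) :
    ∃ C : ℝ, 0 ≤ C ∧ ∀ (b : Fin j → Fin (s + m + 1) → ℤ) (X : Matrix (Fin j) (Fin j) ℤ) (T ρ : ℝ)
      (B : Finset (Fin (s + m + 1))) (hB : B.card = j), (∀ i ∈ B, s < (i : ℕ)) →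
      (Matrix.of fun a c => b a (B.orderEmbOfFin hB c)).det ≠ 0 → X.det ≠ 0 → 1 ≤ T →
      (∀ l a, |∑ i, RA A a i * ∑ k, (X l k : ℝ) * b k i| ≤ ρ) →
      (∀ l i, |∑ k, (X l k : ℝ) * b k i| ≤ T) →
      |(X.det : ℝ)| ≤ C * (ρ * T ^ v) := by
  obtain ⟨k, rfl⟩ : ∃ k, j = k + 1 := ⟨j - 1, by omega⟩
  have hm1 : (1 : ℝ) ≤ m := by exact_mod_cast hj.trans hjm
  obtain ⟨c, hc, hcw⟩ := exists_RAcNorm_ge A (by linarith : 0 < v) hv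
  set e : ℝ := (v + 1 - (k + 1 : ℕ)) / (k + 1 : ℕ) with he
  set F : ℝ := ((k + 1).factorial : ℝ) with hF
  have hF0 : 0 < F := by rw [hF]; exact_mod_cast Nat.factorial_pos (k + 1)
  set κ : ℝ := Fintype.card (Finset (Fin (s + m + 1))) * F with hκ
  have hκ0 : 0 < κ := by
    have : 0 < Fintype.card (Finset (Fin (s + m + 1))) := Fintype.card_pos
    positivity
  set κ' : ℝ := Fintype.card (Fin (s + 1) × Finset (Fin (s + m + 1))) * F with hκ'
  have he0 : 0 ≤ e := by
    have : ((k + 1 : ℕ) : ℝ) ≤ m := by exact_mod_cast hjm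
    apply div_nonneg <;> [linarith; positivity]
  refine ⟨κ' * κ ^ e / c, by positivity, ?_⟩
  intro b X T ρ B hB hBH hdet hX hT hρ hxT
  have hρ0 : 0 ≤ ρ := (abs_nonneg _).trans (hρ 0 0)
  set br : Fin (k + 1) → Fin (s + m + 1) → ℝ := fun a i => (b a i : ℝ) with hbr
  set Xr : Matrix (Fin (k + 1)) (Fin (k + 1)) ℝ := X.map (Int.cast : ℤ → ℝ) with hXr
  set xr : Fin (k + 1) → Fin (s + m + 1) → ℝ := fun a i => ∑ k, Xr a k * br k i with hxr
  have hXdet : Xr.det = (X.det : ℝ) := (Int.cast_det X).symm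
  have hwx := wedgeOf_mul Xr br
  set w : Finset (Fin (s + m + 1)) → ℤ := fun S => if h : S.card = k + 1 then
    (Matrix.of fun a c => b a (S.orderEmbOfFin h c)).det else 0 with hw
  have hwcast : (fun S => (w S : ℝ)) = wedgeOf br := by
    ext S
    simp only [hw, wedgeOf]
    split_ifs with h
    · rw [Int.cast_det]; rfl
    · simp
  have hQ1 := one_le_pibullNorm (s := s) w B hBH (by simpa only [hw, dif_pos hB] using hdet)
  have hR := hcw w (fun S hS => by simp only [hw, dif_neg hS]) hQ1
  rw [hwcast] at hR hQ1
  have hD1 : 1 ≤ |(X.det : ℝ)| := by exact_mod_cast Int.one_le_abs hX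
  have hQle : |(X.det : ℝ)| * pibullNorm s (wedgeOf br) ≤ κ * T ^ (k + 1) := by
    rw [← hXdet, ← pibullNorm_const_mul, ← hwx, pibullNorm, hκ, mul_assoc]
    apply sqrt_sum_le _ (by positivity)
    intro S
    split_ifs
    · rw [wedgeOf]
      split_ifs
      · apply sq_le_sq.2
        rw [abs_of_nonneg (by positivity : 0 ≤ F * T ^ (k + 1))]
        refine (abs_det_le_factorial_mul_prod _ (fun _ => T) fun _ _ => hxT _ _).trans
          (le_of_eq ?_)
        simp [hF]
      · simpa using by positivity
    · positivity
  have hRle : |(X.det : ℝ)| * RAcNorm A (wedgeOf br) ≤ κ' * (ρ * T ^ k) := by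
    rw [← hXdet, ← RAcNorm_const_mul, ← hwx, RAcNorm, hκ', mul_assoc, ← Fintype.sum_prod_type']
    apply sqrt_sum_le _ (by positivity)
    rintro ⟨a, J⟩
    apply sq_le_sq.2
    rw [abs_of_nonneg (by positivity : 0 ≤ F * (ρ * T ^ k))]
    exact abs_RAc_wedgeOf_le A xr hρ hxT a J
  have hT0 : 0 < T := by linarith
  have hQ2 : pibullNorm s (wedgeOf br) ≤ κ * T ^ (k + 1) :=
    le_trans (le_mul_of_one_le_left (by linarith) hD1) hQle
  have hexp : -(v + 1 - (k + 1 : ℕ)) / (k + 1 : ℕ) = -e := by rw [he, neg_div]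
  rw [hexp] at hR
  have hpow : (κ * T ^ (k + 1)) ^ (-e) = (κ ^ e)⁻¹ * (T ^ (v - k))⁻¹ := by
    rw [Real.mul_rpow hκ0.le (by positivity), Real.rpow_neg hκ0.le, ← Real.rpow_natCast,
      ← Real.rpow_mul hT0.le, ← Real.rpow_neg hT0.le]
    congr 2
    rw [he]; field_simp; push_cast; ring
  have h1 : (κ ^ e)⁻¹ * (T ^ (v - k))⁻¹ ≤ pibullNorm s (wedgeOf br) ^ (-e) := by
    rw [← hpow]
    exact Real.rpow_le_rpow_of_nonpos (by linarith) hQ2 (by linarith)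
  have h2 : |(X.det : ℝ)| * (c * ((κ ^ e)⁻¹ * (T ^ (v - k))⁻¹)) ≤ κ' * (ρ * T ^ k) :=
    le_trans (mul_le_mul_of_nonneg_left
      ((mul_le_mul_of_nonneg_left h1 hc.le).trans hR) (abs_nonneg _)) hRle
  have h3 : T ^ v = T ^ (v - k) * T ^ k := by
    rw [← Real.rpow_natCast T k, ← Real.rpow_add hT0]; congr 1; ring
  have hp1 : 0 < κ ^ e := by positivity
  have hp2 : 0 < T ^ (v - k) := by positivity
  rw [h3]
  calc |(X.det : ℝ)| = (|(X.det : ℝ)| * (c * ((κ ^ e)⁻¹ * (T ^ (v - k))⁻¹))) *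
        (κ ^ e * T ^ (v - k) / c) := by field_simp
    _ ≤ (κ' * (ρ * T ^ k)) * (κ ^ e * T ^ (v - k) / c) :=
        mul_le_mul_of_nonneg_right h2 (by positivity)
    _ = _ := by ring

lemma card_filter_fin_lt (s m : ℕ) :
    (Finset.univ.filter fun i : Fin (s + m + 1) => s < (i : ℕ)).card = m := by
  have h : (Finset.univ.filter fun i : Fin (s + m + 1) => s < (i : ℕ)) =
      Finset.Ioi (⟨s, by omega⟩ : Fin (s + m + 1)) := by
    ext i
    simp [Fin.lt_def]
  rw [h, Fin.card_Ioi]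
  dsimp only
  omega

lemma mixedCoord_sum {s m j : ℕ} (A : Matrix (Fin (s + 1)) (Fin m) ℝ) (c : Fin j → ℝ)
    (b : Fin j → Fin (s + m + 1) → ℝ) (i : Fin (s + m + 1)) :
    mixedCoord A (fun i => ∑ k, c k * b k i) i = ∑ k, c k * mixedCoord A (b k) i := by
  by_cases h : s < (i : ℕ)
  · simp [mixedCoord, h]
  · simp only [mixedCoord, dif_neg h, Finset.mul_sum]
    rw [Finset.sum_comm]
    exact Finset.sum_congr rfl fun k _ => Finset.sum_congr rfl fun l _ => by ring

/-- The bound for the index of a family of integer vectors close to the kernel of `R_A`, when a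
suitable minor involves one of the first `s + 1` coordinates. -/
lemma abs_det_le_of_mixedCoord {s m j : ℕ} (A : Matrix (Fin (s + 1)) (Fin m) ℝ)
    (b : Fin j → Fin (s + m + 1) → ℤ) (X : Matrix (Fin j) (Fin j) ℤ) {T ρ : ℝ} (hT : 1 ≤ T)
    (hρ0 : 0 ≤ ρ) (hρ1 : ρ ≤ 1) (B : Finset (Fin (s + m + 1))) (hB : B.card = j)
    (hBH : ∃ i ∈ B, ¬ s < (i : ℕ))
    (hdet : (Matrix.of fun a c => b a (B.orderEmbOfFin hB c)).det ≠ 0)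
    (hmix : (Matrix.of fun a c => mixedCoord A (fun i => (b a i : ℝ)) (B.orderEmbOfFin hB c)).det =
        (Matrix.of fun a c => (b a (B.orderEmbOfFin hB c) : ℝ)).det)
    (hρ : ∀ l a, |∑ i, RA A a i * ∑ k, (X l k : ℝ) * b k i| ≤ ρ)
    (hxT : ∀ l i, |∑ k, (X l k : ℝ) * b k i| ≤ T) :
    |(X.det : ℝ)| ≤ (s + m + 1).factorial * (ρ * T ^ m) := by
  set f := B.orderEmbOfFin hB with hf
  set β : Fin j → ℝ := fun c => if s < (f c : ℕ) then T else ρ with hβ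
  have hβ0 : 0 ≤ ∏ c, β c := Finset.prod_nonneg fun c _ => by
    simp only [hβ]; split_ifs <;> linarith
  have hj : j ≤ s + m + 1 := by
    rw [← hB]; exact (Finset.card_le_univ B).trans (by simp)
  have h1 : (Matrix.of fun a c => mixedCoord A (fun i => ∑ k, (X a k : ℝ) * b k i) (f c)) =
      X.map (Int.cast : ℤ → ℝ) *
        (Matrix.of fun a c => mixedCoord A (fun i => (b a i : ℝ)) (f c)) := by
    ext a c
    rw [Matrix.mul_apply, Matrix.of_apply]
    exact mixedCoord_sum A (fun k => (X a k : ℝ)) (fun k i => (b k i : ℝ)) (f c)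
  have h2 := abs_det_le_factorial_mul_prod
    (Matrix.of fun a c => mixedCoord A (fun i => ∑ k, (X a k : ℝ) * b k i) (f c)) β
    (fun a c => by
      rw [Matrix.of_apply, mixedCoord, hβ]
      dsimp only
      split_ifs with h
      · exact hxT _ _
      · exact hρ _ _)
  have h3 : (1 : ℝ) ≤ |(Matrix.of fun a c => (b a (f c) : ℝ)).det| := by
    have : (Matrix.of fun a c => (b a (f c) : ℝ)).det =
        (((Matrix.of fun a c => b a (f c)).det : ℤ) : ℝ) := by
      rw [Int.cast_det]; rfl
    rw [this]
    exact_mod_cast Int.one_le_abs hdet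
  have h4 : (X.map (Int.cast : ℤ → ℝ)).det = (X.det : ℝ) := (Int.cast_det X).symm
  rw [h1, Matrix.det_mul, hmix, abs_mul, h4] at h2
  have h5 : ∏ c, β c ≤ ρ * T ^ m := by
    rw [hβ, Finset.prod_ite, Finset.prod_const, Finset.prod_const, mul_comm]
    refine mul_le_mul ?_ (pow_le_pow_right₀ hT ?_) (by positivity) hρ0
    · refine pow_le_of_le_one hρ0 hρ1 (Finset.card_ne_zero.2 ?_)
      obtain ⟨i, hi, his⟩ := hBH
      obtain ⟨c, rfl⟩ : i ∈ Set.range f := by rw [hf, Finset.range_orderEmbOfFin]; exact hi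
      exact ⟨c, by simpa using his⟩
    · conv_rhs => rw [← card_filter_fin_lt s m]
      refine Finset.card_le_card_of_injOn f (fun c hc => ?_) f.injective.injOn
      simpa using hc
  calc |(X.det : ℝ)| ≤ |(X.det : ℝ)| * |(Matrix.of fun a c => (b a (f c) : ℝ)).det| :=
        le_mul_of_one_le_right (abs_nonneg _) h3
    _ ≤ j.factorial * ∏ c, β c := h2
    _ ≤ (s + m + 1).factorial * (ρ * T ^ m) := by
        refine mul_le_mul ?_ h5 hβ0 (by positivity)
        exact_mod_cast Nat.factorial_le hj

/-- The number of nonzero integer points in a box of size `T` at which `R_A` is at most `ρ` is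
`O(ρ T^v)` for some `v < n`. -/
lemma exists_card_le {s m : ℕ} (hs : 1 ≤ s) {A : Matrix (Fin (s + 1)) (Fin m) ℝ}
    (hA : DiophCond s m A) : ∃ v C : ℝ, (m : ℝ) ≤ v ∧ v < (s + m : ℕ) ∧ 1 ≤ C ∧
      ∀ T ρ : ℝ, 1 ≤ T → 0 ≤ ρ → ρ ≤ 1 → ∀ S : Finset (Fin (s + m + 1) → ℤ),
        (∀ z ∈ S, z ≠ 0 ∧ (∀ a, |∑ i, RA A a i * z i| ≤ ρ) ∧ ∀ i, |(z i : ℝ)| ≤ T) →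
        (S.card : ℝ) ≤ C * (ρ * T ^ v) := by
  classical
  obtain ⟨v, hmv, hvn, hv⟩ := exists_exponent_notMem_expSet hs hA
  have hC : ∀ j : ℕ, ∃ C : ℝ, 0 ≤ C ∧ (1 ≤ j → j ≤ m →
      ∀ (b : Fin j → Fin (s + m + 1) → ℤ) (X : Matrix (Fin j) (Fin j) ℤ) (T ρ : ℝ)
      (B : Finset (Fin (s + m + 1))) (hB : B.card = j), (∀ i ∈ B, s < (i : ℕ)) →
      (Matrix.of fun a c => b a (B.orderEmbOfFin hB c)).det ≠ 0 → X.det ≠ 0 → 1 ≤ T →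
      (∀ l a, |∑ i, RA A a i * ∑ k, (X l k : ℝ) * b k i| ≤ ρ) →
      (∀ l i, |∑ k, (X l k : ℝ) * b k i| ≤ T) →
      |(X.det : ℝ)| ≤ C * (ρ * T ^ v)) := by
    intro j
    by_cases h : 1 ≤ j ∧ j ≤ m
    · obtain ⟨C, h0, h1⟩ := exists_det_le_of_notMem_expSet h.1 h.2 A hmv (hv j h.1 h.2)
      exact ⟨C, h0, fun _ _ => h1⟩
    · exact ⟨0, le_rfl, fun h1 h2 => absurd ⟨h1, h2⟩ h⟩
  choose C hC0 hC using hC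
  set K : ℝ := (s + m + 1).factorial + ∑ j ∈ Finset.range (m + 1), C j with hK
  have hsum0 : 0 ≤ ∑ j ∈ Finset.range (m + 1), C j := Finset.sum_nonneg fun j _ => hC0 j
  have hF1 : (1 : ℝ) ≤ (s + m + 1).factorial := by
    exact_mod_cast Nat.one_le_iff_ne_zero.2 (Nat.factorial_ne_zero _)
  refine ⟨v, 3 ^ (s + m + 1) * K, hmv, hvn, one_le_mul_of_one_le_of_one_le
    (one_le_pow₀ (by norm_num)) (by linarith), ?_⟩
  intro T ρ hT hρ0 hρ1 S hS
  have hT0 : 0 < T := by linarith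
  rcases S.eq_empty_or_nonempty with rfl | hne
  · rw [Finset.card_empty, Nat.cast_zero]; positivity
  obtain ⟨j, b, X, hb, hX, hXS, hcard⟩ := exists_basis_det_ge_card (insert 0 S)
  have h0S : (0 : Fin (s + m + 1) → ℤ) ∉ S := fun h => (hS 0 h).1 rfl
  rw [Finset.card_insert_of_notMem h0S] at hcard
  have hj : 1 ≤ j := by
    by_contra hj
    obtain rfl : j = 0 := by omega
    exact hne.ne_empty (by simpa using hcard)
  have hx : ∀ l, (∀ a, |∑ i, RA A a i * ((∑ k, X l k • b k) i : ℤ)| ≤ ρ) ∧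
      ∀ i, |(((∑ k, X l k • b k) i : ℤ) : ℝ)| ≤ T := by
    intro l
    rcases Finset.mem_insert.1 (hXS l) with h | h
    · rw [h]; simp [hρ0, hT0.le]
    · exact (hS _ h).2
  simp only [Finset.sum_apply, Pi.smul_apply, smul_eq_mul, Int.cast_sum, Int.cast_mul] at hx
  obtain ⟨B, hB, hdet, hmix⟩ := exists_minor_mixedCoord A b hb
  have hjN : j ≤ s + m + 1 := by
    rw [← hB]; exact (Finset.card_le_univ B).trans (by simp)
  have hpow : (T : ℝ) ^ m ≤ T ^ v := by
    rw [← Real.rpow_natCast]; exact Real.rpow_le_rpow_of_exponent_le hT hmv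
  have hdetle : |(X.det : ℝ)| ≤ K * (ρ * T ^ v) := by
    by_cases hBH : ∀ i ∈ B, s < (i : ℕ)
    · have hjm : j ≤ m := by
        rw [← hB]
        refine (Finset.card_le_card fun i hi => ?_).trans_eq (card_filter_fin_lt s m)
        simpa using hBH i hi
      refine (hC j hj hjm b X T ρ B hB hBH hdet hX hT (fun l => (hx l).1)
        fun l => (hx l).2).trans (mul_le_mul_of_nonneg_right ?_ (by positivity))
      have := Finset.single_le_sum (f := C) (fun j _ => hC0 j)
        (Finset.mem_range.2 (by omega : j < m + 1))
      linarith
    · push Not at hBH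
      refine (abs_det_le_of_mixedCoord A b X hT hρ0 hρ1 B hB (by simpa using hBH) hdet hmix
        (fun l => (hx l).1) fun l => (hx l).2).trans
        (mul_le_mul (by linarith) (mul_le_mul_of_nonneg_left hpow hρ0) (by positivity)
          (by linarith))
  have h1 : (S.card : ℝ) ≤ 3 ^ j * |(X.det : ℝ)| := by
    have h2 : (S.card : ℝ) + 1 ≤ 3 ^ j * (X.det.natAbs : ℝ) := by exact_mod_cast hcard
    rw [Nat.cast_natAbs, Int.cast_abs] at h2
    linarith
  rw [mul_assoc]
  exact h1.trans (mul_le_mul (pow_le_pow_right₀ (by norm_num) hjN) hdetle (abs_nonneg _)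
    (by positivity))

lemma volume_pi_strip_le {s : ℕ} (g : Fin s → ℝ) (a : Fin s) (hg : g a ≠ 0) (c δ : ℝ) {R : ℝ}
    (hR : 0 ≤ R) :
    volume {x : Fin s → ℝ | (∀ i, |x i| ≤ R) ∧ |∑ i, g i * x i + c| < δ} ≤
      ENNReal.ofReal ((2 * R) ^ (s - 1) * (2 * δ) / |g a|) := by
  set M : Matrix (Fin s) (Fin s) ℝ := (1 : Matrix (Fin s) (Fin s) ℝ).updateRow a g with hM
  have hdet : LinearMap.det (Matrix.toLin' M) = g a := by
    rw [LinearMap.det_toLin', hM, ← Matrix.cramer_transpose_apply, Matrix.transpose_one,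
      Matrix.cramer_one]
    rfl
  set I : Fin s → Set ℝ := fun i => if i = a then Ioo (-c - δ) (-c + δ) else Icc (-R) R with hI
  have hsub : {x : Fin s → ℝ | (∀ i, |x i| ≤ R) ∧ |∑ i, g i * x i + c| < δ} ⊆
      Matrix.toLin' M ⁻¹' Set.pi univ I := by
    rintro x ⟨hx, hxg⟩ i -
    rw [Matrix.toLin'_apply]
    by_cases hi : i = a
    · subst hi
      have h1 : (M.mulVec x) i = ∑ k, g k * x k := by
        rw [hM, Matrix.mulVec, Matrix.updateRow_self]; rfl
      rw [abs_lt] at hxg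
      simp only [hI, if_true, h1, mem_Ioo]
      constructor <;> linarith
    · have h1 : (M.mulVec x) i = x i := by
        rw [hM, Matrix.mulVec, Matrix.updateRow_ne hi]
        exact congrFun (Matrix.one_mulVec x) i
      simp only [hI, if_neg hi, h1]
      exact abs_le.1 (hx i)
  have hvol : volume (Set.pi univ I) = ENNReal.ofReal ((2 * R) ^ (s - 1) * (2 * δ)) := by
    rw [volume_pi_pi, ← Finset.prod_erase_mul _ _ (Finset.mem_univ a)]
    have h1 : ∀ i ∈ Finset.univ.erase a, volume (I i) = ENNReal.ofReal (2 * R) := fun i hi => by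
      rw [hI]; dsimp only
      rw [if_neg (Finset.ne_of_mem_erase hi), Real.volume_Icc]
      congr 1; ring
    have h2 : volume (I a) = ENNReal.ofReal (2 * δ) := by
      rw [hI]; dsimp only
      rw [if_pos rfl, Real.volume_Ioo]
      congr 1; ring
    rw [Finset.prod_congr rfl h1, h2, Finset.prod_const, Finset.card_erase_of_mem
      (Finset.mem_univ a), Finset.card_univ, Fintype.card_fin,
      ← ENNReal.ofReal_pow (by positivity), ← ENNReal.ofReal_mul (by positivity)]
  refine (measure_mono hsub).trans (le_of_eq ?_)
  rw [Measure.addHaar_preimage_linearMap _ (by rwa [hdet]), hvol, hdet, abs_inv,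
    ← ENNReal.ofReal_mul (by positivity)]
  congr 1
  ring

lemma volume_strip_le {s : ℕ} (g : Fin s → ℝ) (a : Fin s) (hg : g a ≠ 0) (c δ : ℝ) {R : ℝ}
    (hR : 0 ≤ R) :
    volume {x : EuclideanSpace ℝ (Fin s) | (∀ i, |x i| ≤ R) ∧ |∑ i, g i * x i + c| < δ} ≤
      ENNReal.ofReal ((2 * R) ^ (s - 1) * (2 * δ) / |g a|) := by
  rw [← (EuclideanSpace.volume_preserving_symm_measurableEquiv_toLp
    (Fin s)).symm.measure_preimage_equiv]
  exact volume_pi_strip_le g a hg c δ hR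

lemma sum_inv_le_mul_harmonic {ι : Type*} (Z : Finset ι) (ρ : ι → ℝ) {H : ℝ}
    (h0 : ∀ z ∈ Z, 0 < ρ z)
    (h : ∀ z ∈ Z, ∀ Y ⊆ Z, (∀ y ∈ Y, ρ y ≤ ρ z) → (Y.card : ℝ) ≤ H * ρ z) :
    ∑ z ∈ Z, (ρ z)⁻¹ ≤ H * (harmonic Z.card : ℚ) := by
  classical
  induction Z using Finset.induction_on_max_value ρ with
  | empty => simp
  | insert a Z ha hmax ih =>
    have hρ : 0 < ρ a := h0 a (Finset.mem_insert_self _ _)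
    have ih' := ih (fun z hz => h0 z (Finset.mem_insert_of_mem hz)) fun z hz Y hY =>
      h z (Finset.mem_insert_of_mem hz) Y (hY.trans (Finset.subset_insert _ _))
    have h1 := h a (Finset.mem_insert_self _ _) _ (Finset.Subset.refl _) fun y hy => by
      rcases Finset.mem_insert.1 hy with rfl | hy
      · exact le_rfl
      · exact hmax y hy
    rw [Finset.card_insert_of_notMem ha] at h1 ⊢
    rw [Finset.sum_insert ha, harmonic_succ]
    push_cast at h1 ⊢
    have h2 : (ρ a)⁻¹ ≤ H * ((Z.card : ℝ) + 1)⁻¹ := by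
      rw [← div_eq_mul_inv, le_div_iff₀ (by positivity), inv_mul_le_iff₀ hρ]
      linarith
    linarith

/-- A family of real numbers in `(0, 1]` with at most `H y` members below `y` has
inverse sum `O(H log H)`, hence `O(H^e)` for every `e > 1`. -/
lemma sum_inv_le_rpow {ι : Type*} (Z : Finset ι) (ρ : ι → ℝ) {H ε : ℝ} (hH : 1 ≤ H)
    (hε : 0 < ε) (h0 : ∀ z ∈ Z, 0 < ρ z) (h1 : ∀ z ∈ Z, ρ z ≤ 1)
    (h : ∀ y : ℝ, 0 < y → y ≤ 1 → ∀ Y ⊆ Z, (∀ z ∈ Y, ρ z ≤ y) → (Y.card : ℝ) ≤ H * y) :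
    ∑ z ∈ Z, (ρ z)⁻¹ ≤ (1 + ε⁻¹) * H ^ (1 + ε) := by
  have hcard : (Z.card : ℝ) ≤ H := by
    simpa using h 1 one_pos le_rfl Z (Finset.Subset.refl _) h1
  have hH0 : 0 < H := by linarith
  have hlog : (harmonic Z.card : ℝ) ≤ (1 + ε⁻¹) * H ^ ε := by
    have h2 : 1 ≤ H ^ ε := Real.one_le_rpow hH hε.le
    have h3 : Real.log H ≤ H ^ ε / ε := Real.log_le_rpow_div hH0.le hε
    have h4 : Real.log Z.card ≤ Real.log H := by
      rcases Nat.eq_zero_or_pos Z.card with h | h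
      · rw [h, Nat.cast_zero, Real.log_zero]; exact Real.log_nonneg hH
      · exact Real.log_le_log (by exact_mod_cast h) hcard
    have h5 := harmonic_le_one_add_log Z.card
    rw [div_eq_mul_inv] at h3
    linarith
  refine (sum_inv_le_mul_harmonic Z ρ h0 fun z hz Y hY hY' =>
    h _ (h0 z hz) (h1 z hz) Y hY hY').trans ?_
  rw [Real.rpow_add hH0, Real.rpow_one]
  calc H * (harmonic Z.card : ℝ) ≤ H * ((1 + ε⁻¹) * H ^ ε) := mul_le_mul_of_nonneg_left hlog hH0.le
    _ = _ := by ring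

lemma summable_dyadic {n : ℕ} (hn : 1 ≤ n) {ψ : ℝ → ℝ} (hmono : AntitoneOn ψ (Ici 0))
    (hnn : ∀ x ∈ Ici (0 : ℝ), 0 ≤ ψ x)
    (hsum : Summable fun q : {q : Fin n → ℤ // q ≠ 0} => ψ (‖q.1‖ ^ n)) :
    Summable fun t : ℕ => ((2 : ℝ) ^ t) ^ n * ψ (((2 : ℝ) ^ t) ^ n) := by
  have : NeZero n := ⟨by omega⟩
  set F : (Σ t : ℕ, (Fin n → Fin (2 ^ t))) → {q : Fin n → ℤ // q ≠ 0} := fun σ =>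
    ⟨fun i => ((2 ^ σ.1 + (σ.2 i : ℕ) : ℕ) : ℤ), fun h => by
      have h1 := congrFun h 0
      have h2 : 0 < 2 ^ σ.1 := by positivity
      simp only [Pi.zero_apply] at h1
      omega⟩ with hF
  have hinj : Function.Injective F := by
    rintro ⟨t, f⟩ ⟨t', f'⟩ h
    have h1 : ∀ i, 2 ^ t + (f i : ℕ) = 2 ^ t' + (f' i : ℕ) := fun i => by
      have := congrFun (congrArg Subtype.val h) i
      simp only [hF] at this
      exact_mod_cast this
    have hlog : ∀ (t : ℕ) (a : Fin (2 ^ t)), Nat.log 2 (2 ^ t + (a : ℕ)) = t := fun t a =>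
      Nat.log_eq_of_pow_le_of_lt_pow (by omega) (by have := a.isLt; rw [pow_succ]; omega)
    obtain rfl : t = t' := by rw [← hlog t (f 0), h1 0, hlog]
    have : f = f' := funext fun i => Fin.ext (by have := h1 i; omega)
    rw [this]
  have hnorm : ∀ σ, ‖(F σ).1‖ ≤ 2 ^ (σ.1 + 1) := fun σ => by
    rw [pi_norm_le_iff_of_nonneg (by positivity)]
    intro i
    have h1 : 2 ^ σ.1 + (σ.2 i : ℕ) ≤ 2 ^ (σ.1 + 1) := by
      have := (σ.2 i).isLt; rw [pow_succ]; omega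
    rw [Int.norm_eq_abs]
    simp only [hF, Int.cast_natCast, Nat.abs_cast]
    exact_mod_cast h1
  have h1 : Summable fun σ : (Σ t : ℕ, (Fin n → Fin (2 ^ t))) => ψ (((2 : ℝ) ^ (σ.1 + 1)) ^ n) :=
    Summable.of_nonneg_of_le (fun σ => hnn _ (by rw [mem_Ici]; positivity))
      (fun σ => hmono (by rw [mem_Ici]; positivity) (by rw [mem_Ici]; positivity)
        (pow_le_pow_left₀ (norm_nonneg _) (hnorm σ) n))
      (hsum.comp_injective hinj)
  have h2 := h1.sigma
  simp only [tsum_fintype, Finset.sum_const, Finset.card_univ, Fintype.card_pi, Fintype.card_fin,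
    Finset.prod_const, nsmul_eq_mul] at h2
  rw [← summable_nat_add_iff 1]
  refine (h2.mul_left ((2 : ℝ) ^ n)).congr fun t => ?_
  push_cast
  rw [← mul_assoc, ← mul_pow, pow_succ 2 t, mul_comm (2 : ℝ) (2 ^ t)]

lemma sum_RA_mul_eq {s m : ℕ} (A : Matrix (Fin (s + 1)) (Fin m) ℝ) (z : Fin (s + m + 1) → ℝ)
    (a : Fin (s + 1)) :
    ∑ i, RA A a i * z i = (if a = 0 then z 0 else 0) +
      (∑ i : Fin s, if i.succ = a then z (Fin.castAdd m i).succ else 0) +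
      ∑ j, A a j * z (Fin.natAdd s j).succ := by
  rw [Fin.sum_univ_succ, Fin.sum_univ_add, ← add_assoc]
  congr 1
  · congr 1
    · by_cases h : a = 0 <;> simp [RA, h, eq_comm]
    · refine Finset.sum_congr rfl fun i _ => ?_
      simp [RA, Fin.ext_iff]
  · refine Finset.sum_congr rfl fun j _ => ?_
    have h1 : ¬ (((Fin.natAdd s j).succ : Fin (s + m + 1)) : ℕ) < s + 1 := by simp
    have h2 : (⟨(((Fin.natAdd s j).succ : Fin (s + m + 1)) : ℕ) - (s + 1), by
        simp⟩ : Fin m) = j := by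
      ext; simp
    rw [RA, dif_neg h1, h2]

lemma sum_RA_zero {s m : ℕ} (A : Matrix (Fin (s + 1)) (Fin m) ℝ) (z : Fin (s + m + 1) → ℤ) :
    ∑ i, RA A 0 i * (z i : ℝ) = z 0 + ∑ j, A 0 j * (Fin.tail z (Fin.natAdd s j) : ℝ) := by
  rw [sum_RA_mul_eq A fun i => (z i : ℝ)]
  simp [Fin.tail, Fin.succ_ne_zero]

lemma sum_RA_succ {s m : ℕ} (A : Matrix (Fin (s + 1)) (Fin m) ℝ) (z : Fin (s + m + 1) → ℤ)
    (a : Fin s) : ∑ i, RA A a.succ i * (z i : ℝ) = gradA A (Fin.tail z) a := by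
  rw [sum_RA_mul_eq A fun i => (z i : ℝ)]
  simp [Fin.tail, Fin.succ_ne_zero, gradA]

lemma dotA_eq {s m : ℕ} (A : Matrix (Fin (s + 1)) (Fin m) ℝ) (x : Fin s → ℝ)
    (q : Fin (s + m) → ℤ) : dotA A x q =
      ∑ a, gradA A q a * x a + ∑ j, A 0 j * (q (Fin.natAdd s j) : ℝ) := by
  simp only [dotA, phiA, Fin.sum_univ_add, Fin.append_left, Fin.append_right, Matrix.vecMul,
    dotProduct, tilde, Fin.sum_univ_succ, Fin.cons_zero, Fin.cons_succ, gradA, add_mul,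
    Finset.sum_add_distrib, Finset.sum_mul, one_mul]
  rw [Finset.sum_comm (s := Finset.univ (α := Fin m)) (t := Finset.univ (α := Fin s))]
  have h1 : ∀ i : Fin s, x i * (q (Fin.castAdd m i) : ℝ) = (q (Fin.castAdd m i) : ℝ) * x i :=
    fun i => mul_comm _ _
  have h2 : ∀ (i : Fin s) (j : Fin m), x i * A i.succ j * (q (Fin.natAdd s j) : ℝ) =
      A i.succ j * (q (Fin.natAdd s j) : ℝ) * x i := fun i j => by ring
  simp only [h1, h2]
  ring

lemma card_le_of_abs_add_le (Y : Finset ℤ) (c : ℝ) {w : ℝ} (hw : 0 ≤ w)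
    (h : ∀ p ∈ Y, |(p : ℝ) + c| ≤ w) : (Y.card : ℝ) ≤ 2 * w + 1 := by
  have hsub : Y ⊆ Finset.Icc ⌈-c - w⌉ ⌊-c + w⌋ := fun p hp => by
    have := abs_le.1 (h p hp)
    rw [Finset.mem_Icc, Int.ceil_le, Int.le_floor]
    constructor <;> linarith
  have h1 : (Y.card : ℝ) ≤ ((⌊-c + w⌋ + 1 - ⌈-c - w⌉).toNat : ℝ) := by
    rw [← Int.card_Icc]
    exact_mod_cast Finset.card_le_card hsub
  refine h1.trans ?_
  have h2 : (((⌊-c + w⌋ + 1 - ⌈-c - w⌉).toNat : ℤ) : ℝ) ≤ 2 * w + 1 := by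
    rw [Int.toNat_eq_max]
    push_cast
    rw [max_le_iff]
    have := Int.floor_le (-c + w)
    have := Int.le_ceil (-c - w)
    constructor <;> linarith
  exact_mod_cast h2

lemma exists_sum_inv_gradA_le {s m : ℕ} (hs : 1 ≤ s) (hm : 1 ≤ m)
    {A : Matrix (Fin (s + 1)) (Fin m) ℝ} (hA : DiophCond s m A) {R : ℝ} (hR : 1 ≤ R) :
    ∃ v K : ℝ, 0 < v ∧ v < (s + m : ℕ) ∧ 1 ≤ K ∧ ∀ T δ : ℝ, 1 ≤ T → 0 ≤ δ →
      K * T ^ v * δ < 1 → ∀ Z : Finset (Fin (s + m + 1) → ℤ),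
      (∀ z ∈ Z, z ≠ 0 ∧ (∀ i, |(z i : ℝ)| ≤ T) ∧
        |∑ i, RA A 0 i * (z i : ℝ)| ≤ δ + R * ‖gradA A (Fin.tail z)‖) →
      (∀ z ∈ Z, 0 < ‖gradA A (Fin.tail z)‖) ∧
        ∑ z ∈ Z, ‖gradA A (Fin.tail z)‖⁻¹ ≤ K * T ^ (s + m) := by
  classical
  obtain ⟨v, C, hmv, hvn, hC, hcard⟩ := exists_card_le hs hA
  have hm1 : (1 : ℝ) ≤ m := by exact_mod_cast hm
  have hv0 : 0 < v := by linarith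
  set ε : ℝ := (s + m : ℕ) / v - 1 with hε
  have hε0 : 0 < ε := by rw [hε, sub_pos, one_lt_div hv0]; exact hvn
  set K : ℝ := 2 * R * ((1 + ε⁻¹) * C ^ (1 + ε) + 3 * 3 ^ (s + m)) + 2 * C with hK
  have hC0 : 0 < C := by linarith
  have hR0 : 0 < R := by linarith
  have hKC : 2 * C ≤ K := by
    rw [hK, le_add_iff_nonneg_left]
    positivity
  refine ⟨v, K, hv0, hvn, by linarith, ?_⟩
  intro T δ hT hδ hδT Z hZ
  have hT0 : 0 < T := by linarith
  set H : ℝ := C * T ^ v with hH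
  have hTv : 1 ≤ T ^ v := Real.one_le_rpow hT hv0.le
  have hH1 : 1 ≤ H := one_le_mul_of_one_le_of_one_le hC hTv
  have hHδ : 2 * H * δ < 1 := lt_of_le_of_lt (mul_le_mul_of_nonneg_right
    (by rw [hH]; nlinarith) hδ) hδT
  have hδ2 : 2 * δ ≤ 1 := by nlinarith
  set G : (Fin (s + m + 1) → ℤ) → ℝ := fun z => ‖gradA A (Fin.tail z)‖ with hG
  have hGn : ∀ z, 0 ≤ G z := fun z => norm_nonneg _
  have hrow : ∀ z, ∀ ρ : ℝ, |∑ i, RA A 0 i * (z i : ℝ)| ≤ ρ → G z ≤ ρ →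
      ∀ a, |∑ i, RA A a i * (z i : ℝ)| ≤ ρ := by
    intro z ρ h0 h1 a
    refine Fin.cases h0 (fun a => ?_) a
    rw [sum_RA_succ, ← Real.norm_eq_abs]
    exact (norm_le_pi_norm _ a).trans h1
  have hGδ : ∀ z ∈ Z, δ < R * G z := by
    intro z hz
    obtain ⟨hz0, hzT, hzL⟩ := hZ z hz
    by_contra! hcon
    have hGz : G z ≤ R * G z := le_mul_of_one_le_left (hGn z) hR
    have h1 := hcard T (2 * δ) hT (by linarith) hδ2 {z} (by
      intro y hy
      rw [Finset.mem_singleton] at hy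
      subst hy
      exact ⟨hz0, hrow _ _ (hzL.trans (by linarith [show R * G y ≤ δ from hcon])) (by linarith),
        hzT⟩)
    rw [Finset.card_singleton, Nat.cast_one] at h1
    have : C * (2 * δ * T ^ v) = 2 * H * δ := by rw [hH]; ring
    linarith
  have hGpos : ∀ z ∈ Z, 0 < G z := fun z hz =>
    pos_of_mul_pos_right (hδ.trans_lt (hGδ z hz)) hR0.le
  refine ⟨hGpos, ?_⟩
  set σ : (Fin (s + m + 1) → ℤ) → ℝ := fun z => 2 * R * G z with hσ
  have hσpos : ∀ z ∈ Z, 0 < σ z := fun z hz => by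
    have := hGpos z hz
    positivity
  have hLσ : ∀ z ∈ Z, ∀ a, |∑ i, RA A a i * (z i : ℝ)| ≤ σ z := fun z hz => by
    have h1 := (hZ z hz).2.2
    have h2 := hGδ z hz
    refine hrow z _ (h1.trans ?_) ?_
    · simp only [hσ]; linarith [show δ + R * G z ≤ 2 * R * G z by linarith]
    · simp only [hσ]; nlinarith [hGn z]
  have hZ1 : ∑ z ∈ Z.filter (fun z => σ z ≤ 1), (σ z)⁻¹ ≤
      (1 + ε⁻¹) * C ^ (1 + ε) * T ^ (s + m) := by
    refine (sum_inv_le_rpow _ σ hH1 hε0 (fun z hz => hσpos z (Finset.mem_filter.1 hz).1)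
      (fun z hz => (Finset.mem_filter.1 hz).2) ?_).trans (le_of_eq ?_)
    · intro y hy hy1 Y hY hYy
      rw [hH, mul_assoc, mul_comm (T ^ v)]
      refine hcard T y hT hy.le hy1 Y fun z hz => ?_
      have hzZ := (Finset.mem_filter.1 (hY hz)).1
      exact ⟨(hZ z hzZ).1, fun a => (hLσ z hzZ a).trans (hYy z hz), (hZ z hzZ).2.1⟩
    · rw [hH, Real.mul_rpow hC0.le (by positivity), ← Real.rpow_mul hT0.le]
      have : v * (1 + ε) = (s + m : ℕ) := by rw [hε]; field_simp; ring
      rw [this, Real.rpow_natCast, mul_assoc]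
  have hZ2 : ∑ z ∈ Z.filter (fun z => ¬ σ z ≤ 1), (σ z)⁻¹ ≤ 3 * 3 ^ (s + m) * T ^ (s + m) := by
    set W : Finset (Fin (s + m) → ℤ) := Fintype.piFinset fun _ => Finset.Icc (-⌊T⌋) ⌊T⌋ with hW
    have hWcard : (W.card : ℝ) ≤ 3 ^ (s + m) * T ^ (s + m) := by
      rw [hW, Fintype.card_piFinset, Finset.prod_const, Finset.card_univ, Fintype.card_fin,
        Nat.cast_pow, ← mul_pow]
      refine pow_le_pow_left₀ (by positivity) ?_ _
      have h1 := card_le_of_abs_add_le (Finset.Icc (-⌊T⌋) ⌊T⌋) 0 hT0.le fun p hp => by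
        have h2 := Finset.mem_Icc.1 hp
        have h3 : (p : ℝ) ≤ ⌊T⌋ := by exact_mod_cast h2.2
        have h4 : (-⌊T⌋ : ℝ) ≤ p := by exact_mod_cast h2.1
        have h5 := Int.floor_le T
        rw [add_zero, abs_le]
        constructor <;> linarith
      linarith
    rw [← Finset.sum_fiberwise_of_maps_to (t := W) (g := Fin.tail)]
    · have hfib : ∀ q ∈ W, ∑ z ∈ (Z.filter (fun z => ¬ σ z ≤ 1)).filter (fun z => Fin.tail z = q),
          (σ z)⁻¹ ≤ 3 := by
        intro q _
        set Y := (Z.filter (fun z => ¬ σ z ≤ 1)).filter (fun z => Fin.tail z = q) with hY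
        rcases Y.eq_empty_or_nonempty with hY0 | ⟨y, hy⟩
        · rw [hY0]; simp
        have hmem : ∀ z ∈ Y, z ∈ Z ∧ 1 < σ z ∧ Fin.tail z = q := fun z hz => by
          have h1 := Finset.mem_filter.1 hz
          have h2 := Finset.mem_filter.1 h1.1
          exact ⟨h2.1, not_le.1 h2.2, h1.2⟩
        have hconst : ∀ z ∈ Y, σ z = σ y := fun z hz => by
          simp only [hσ, hG, (hmem z hz).2.2, (hmem y hy).2.2]
        have hσy := (hmem y hy).2.1
        have hc : (Y.card : ℝ) ≤ 3 * σ y := by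
          have hinj : Set.InjOn (fun z : Fin (s + m + 1) → ℤ => z 0) Y := fun z hz z' hz' h => by
            rw [← Fin.cons_self_tail z, ← Fin.cons_self_tail z', (hmem z hz).2.2,
              (hmem z' hz').2.2]
            exact congrArg (fun p : ℤ => (Fin.cons p q : Fin (s + m + 1) → ℤ)) h
          have h1 := card_le_of_abs_add_le (Y.image fun z => z 0)
            (∑ j, A 0 j * (q (Fin.natAdd s j) : ℝ)) (w := δ + σ y / 2) (by linarith) (by
              intro p hp
              obtain ⟨z, hz, rfl⟩ := Finset.mem_image.1 hp
              have h2 := (hZ z (hmem z hz).1).2.2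
              rw [sum_RA_zero, (hmem z hz).2.2] at h2
              refine h2.trans (le_of_eq ?_)
              rw [← hconst z hz]
              simp only [hσ, hG, (hmem z hz).2.2]
              ring)
          rw [Finset.card_image_of_injOn hinj] at h1
          linarith
        rw [Finset.sum_congr rfl fun z hz => by rw [hconst z hz], Finset.sum_const, nsmul_eq_mul,
          ← div_eq_mul_inv, div_le_iff₀ (by linarith)]
        exact hc
      refine (Finset.sum_le_card_nsmul _ _ _ hfib).trans ?_
      rw [nsmul_eq_mul]
      linarith
    · intro z hz
      have hzT := (hZ z (Finset.mem_filter.1 hz).1).2.1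
      rw [hW, Fintype.mem_piFinset]
      intro i
      have := abs_le.1 (hzT i.succ)
      rw [Finset.mem_Icc, neg_le, Int.le_floor, Int.le_floor]
      push_cast
      exact ⟨by simp only [Fin.tail]; linarith, this.2⟩
  have hsplit := Finset.sum_filter_add_sum_filter_not Z (fun z => σ z ≤ 1) fun z => (σ z)⁻¹
  have hσG : ∑ z ∈ Z, (G z)⁻¹ = 2 * R * ∑ z ∈ Z, (σ z)⁻¹ := by
    rw [Finset.mul_sum]
    refine Finset.sum_congr rfl fun z hz => ?_
    have := (hGpos z hz).ne'
    simp only [hσ]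
    field_simp
  rw [hσG, ← hsplit]
  calc 2 * R * (∑ z ∈ Z.filter (fun z => σ z ≤ 1), (σ z)⁻¹ +
        ∑ z ∈ Z.filter (fun z => ¬ σ z ≤ 1), (σ z)⁻¹)
      ≤ 2 * R * ((1 + ε⁻¹) * C ^ (1 + ε) * T ^ (s + m) + 3 * 3 ^ (s + m) * T ^ (s + m)) :=
        mul_le_mul_of_nonneg_left (add_le_add hZ1 hZ2) (by positivity)
    _ ≤ K * T ^ (s + m) := by
        rw [hK]
        have : 0 ≤ 2 * C * T ^ (s + m) := by positivity
        linarith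

lemma volume_strip_le_div_norm {s : ℕ} (g : Fin s → ℝ) (hg : 0 < ‖g‖) (c : ℝ) {δ R : ℝ}
    (hδ : 0 ≤ δ) (hR : 0 ≤ R) :
    volume {x : EuclideanSpace ℝ (Fin s) | (∀ i, |x i| ≤ R) ∧ |∑ i, g i * x i + c| < δ} ≤
      ENNReal.ofReal ((2 * R) ^ (s - 1) * (2 * δ) * ‖g‖⁻¹) := by
  obtain ⟨a, ha⟩ : ∃ a, ‖g‖ ≤ |g a| := by
    by_contra! h
    exact lt_irrefl _ ((pi_norm_lt_iff hg).2 h)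
  have ha0 : g a ≠ 0 := abs_pos.1 (hg.trans_le ha)
  refine (volume_strip_le g a ha0 c δ hR).trans (ENNReal.ofReal_le_ofReal ?_)
  rw [div_eq_mul_inv]
  exact mul_le_mul_of_nonneg_left (inv_anti₀ hg ha) (by positivity)

lemma exists_volume_block_le {s m : ℕ} (hs : 1 ≤ s) (hm : 1 ≤ m)
    {A : Matrix (Fin (s + 1)) (Fin m) ℝ} (hA : DiophCond s m A) {R : ℝ} (hR : 1 ≤ R) :
    ∃ v K : ℝ, 0 < v ∧ v < (s + m : ℕ) ∧ 0 < K ∧ ∀ Q δ : ℝ, 1 ≤ Q → 0 ≤ δ → K * Q ^ v * δ < 1 →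
      volume {x : EuclideanSpace ℝ (Fin s) | (∀ i, |x i| ≤ R) ∧ ∃ q : Fin (s + m) → ℤ, q ≠ 0 ∧
        (∀ i, |(q i : ℝ)| ≤ Q) ∧ ∃ p : ℤ, |dotA A (fun i => x i) q + p| < δ} ≤
      ENNReal.ofReal (K * (Q ^ (s + m) * δ)) := by
  classical
  have hs1 : (1 : ℝ) ≤ s := by exact_mod_cast hs
  have hR0 : 0 < R := by linarith
  have hsR : 1 ≤ s * R := one_le_mul_of_one_le_of_one_le hs1 hR
  obtain ⟨v, K₀, hv0, hvn, hK₀, hsum⟩ := exists_sum_inv_gradA_le hs hm hA hsR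
  set α : ℝ := ∑ a, ∑ j, |A a j| with hα
  have hα0 : 0 ≤ α := Finset.sum_nonneg fun a _ => Finset.sum_nonneg fun j _ => abs_nonneg _
  set C : ℝ := 1 + α + s * R * (1 + α) with hC
  have hC1 : 1 ≤ C := by
    have : 0 ≤ s * R * (1 + α) := by positivity
    linarith
  have hK₀0 : 0 < K₀ := by linarith
  have hC0 : 0 < C := by linarith
  have hrow : ∀ (a : Fin (s + 1)) (q : Fin (s + m) → ℤ) (Q : ℝ), (∀ i, |(q i : ℝ)| ≤ Q) → 0 ≤ Q →
      |∑ j, A a j * (q (Fin.natAdd s j) : ℝ)| ≤ α * Q := by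
    intro a q Q hq hQ
    calc |∑ j, A a j * (q (Fin.natAdd s j) : ℝ)|
        ≤ ∑ j, |A a j * (q (Fin.natAdd s j) : ℝ)| := Finset.abs_sum_le_sum_abs _ _
      _ ≤ ∑ j, |A a j| * Q := Finset.sum_le_sum fun j _ => by
          rw [abs_mul]; exact mul_le_mul_of_nonneg_left (hq _) (abs_nonneg _)
      _ = (∑ j, |A a j|) * Q := (Finset.sum_mul _ _ _).symm
      _ ≤ α * Q := mul_le_mul_of_nonneg_right (Finset.single_le_sum
          (f := fun a => ∑ j, |A a j|) (fun a _ => Finset.sum_nonneg fun j _ => abs_nonneg _)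
          (Finset.mem_univ a)) hQ
  set K : ℝ := K₀ * C ^ v + (2 * R) ^ (s - 1) * 2 * (K₀ * C ^ (s + m)) with hK
  have hK1 : 0 < K₀ * C ^ v := by positivity
  have hK2 : 0 < (2 * R) ^ (s - 1) * 2 * (K₀ * C ^ (s + m)) := by positivity
  refine ⟨v, K, hv0, hvn, by linarith, ?_⟩
  intro Q δ hQ hδ hδQ
  have hQ0 : 0 < Q := by linarith
  set T : ℝ := C * Q with hT
  have hQT : Q ≤ T := le_mul_of_one_le_left hQ0.le hC1
  have hT1 : 1 ≤ T := hQ.trans hQT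
  have hδT : K₀ * T ^ v * δ < 1 := by
    refine lt_of_le_of_lt ?_ hδQ
    rw [hT, Real.mul_rpow hC0.le hQ0.le, ← mul_assoc]
    refine mul_le_mul_of_nonneg_right (mul_le_mul_of_nonneg_right ?_ (by positivity)) hδ
    linarith
  have hδ1 : δ ≤ 1 := by
    have h1 : 1 ≤ K₀ * T ^ v :=
      one_le_mul_of_one_le_of_one_le hK₀ (Real.one_le_rpow hT1 hv0.le)
    nlinarith
  set Z : Finset (Fin (s + m + 1) → ℤ) :=
    (Fintype.piFinset fun _ => Finset.Icc (-⌊T⌋) ⌊T⌋).filter fun z => z ≠ 0 ∧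
      |∑ i, RA A 0 i * (z i : ℝ)| ≤ δ + s * R * ‖gradA A (Fin.tail z)‖ with hZ
  have hmemZ : ∀ z, z ∈ Z ↔ (∀ i, |(z i : ℝ)| ≤ T) ∧ z ≠ 0 ∧
      |∑ i, RA A 0 i * (z i : ℝ)| ≤ δ + s * R * ‖gradA A (Fin.tail z)‖ := fun z => by
    rw [hZ, Finset.mem_filter, Fintype.mem_piFinset]
    refine and_congr_left' (forall_congr' fun i => ?_)
    rw [Finset.mem_Icc, neg_le, Int.le_floor, Int.le_floor, abs_le, neg_le]
    push_cast
    rfl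
  obtain ⟨hpos, hsumZ⟩ := hsum T δ hT1 hδ hδT Z fun z hz =>
    ⟨((hmemZ z).1 hz).2.1, ((hmemZ z).1 hz).1, ((hmemZ z).1 hz).2.2⟩
  set E : (Fin (s + m + 1) → ℤ) → Set (EuclideanSpace ℝ (Fin s)) := fun z =>
    {x | (∀ i, |x i| ≤ R) ∧
      |∑ i, gradA A (Fin.tail z) i * x i + ∑ i, RA A 0 i * (z i : ℝ)| < δ} with hE
  have hsub : {x : EuclideanSpace ℝ (Fin s) | (∀ i, |x i| ≤ R) ∧ ∃ q : Fin (s + m) → ℤ, q ≠ 0 ∧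
      (∀ i, |(q i : ℝ)| ≤ Q) ∧ ∃ p : ℤ, |dotA A (fun i => x i) q + p| < δ} ⊆ ⋃ z ∈ Z, E z := by
    rintro x ⟨hx, q, hq0, hq, p, hp⟩
    set z : Fin (s + m + 1) → ℤ := Fin.cons p q with hz
    have hzt : Fin.tail z = q := Fin.tail_cons _ _
    have hL : dotA A (fun i => x i) q + p =
        ∑ i, gradA A q i * x i + ∑ i, RA A 0 i * (z i : ℝ) := by
      rw [dotA_eq, sum_RA_zero, hzt, hz, Fin.cons_zero]
      ring
    have hgx : |∑ i, gradA A q i * x i| ≤ s * R * ‖gradA A q‖ := by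
      refine (Finset.abs_sum_le_sum_abs _ _).trans ?_
      have : ∀ i ∈ (Finset.univ : Finset (Fin s)), |gradA A q i * x i| ≤ ‖gradA A q‖ * R :=
        fun i _ => by
          rw [abs_mul]
          exact mul_le_mul (norm_le_pi_norm (gradA A q) i) (hx i) (abs_nonneg _) (norm_nonneg _)
      refine (Finset.sum_le_card_nsmul _ _ _ this).trans (le_of_eq ?_)
      rw [Finset.card_univ, Fintype.card_fin, nsmul_eq_mul]
      ring
    have hgQ : ‖gradA A q‖ ≤ (1 + α) * Q := by
      rw [pi_norm_le_iff_of_nonneg (by positivity)]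
      intro a
      rw [Real.norm_eq_abs, gradA, add_mul, one_mul]
      exact (abs_add_le _ _).trans (add_le_add (hq _) (hrow _ q Q hq hQ0.le))
    have hp' := hp
    rw [hL] at hp'
    have hL0 : |∑ i, RA A 0 i * (z i : ℝ)| ≤ δ + s * R * ‖gradA A q‖ := by
      rw [abs_lt] at hp'
      rw [abs_le] at hgx ⊢
      constructor <;> linarith
    refine Set.mem_biUnion (x := z) ?_ ⟨hx, by rw [hzt]; exact hp'⟩
    rw [Finset.mem_coe, hmemZ, hzt]
    refine ⟨fun i => ?_, fun h => hq0 (by rw [← hzt, h]; rfl), hL0⟩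
    refine Fin.cases ?_ (fun i => ?_) i
    · rw [sum_RA_zero, hzt] at hL0
      have h1 := abs_le.1 (hrow 0 q Q hq hQ0.le)
      have h2 : s * R * ‖gradA A q‖ ≤ s * R * ((1 + α) * Q) :=
        mul_le_mul_of_nonneg_left hgQ (by linarith)
      rw [abs_le] at hL0 ⊢
      rw [hT, hC]
      constructor <;> linarith
    · rw [hz, Fin.cons_succ]
      exact (hq i).trans hQT
  calc volume _ ≤ volume (⋃ z ∈ Z, E z) := measure_mono hsub
    _ ≤ ∑ z ∈ Z, volume (E z) := measure_biUnion_finset_le Z E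
    _ ≤ ∑ z ∈ Z, ENNReal.ofReal
          ((2 * R) ^ (s - 1) * (2 * δ) * ‖gradA A (Fin.tail z)‖⁻¹) :=
        Finset.sum_le_sum fun z hz => volume_strip_le_div_norm _ (hpos z hz) _ hδ hR0.le
    _ = ENNReal.ofReal ((2 * R) ^ (s - 1) * (2 * δ) * ∑ z ∈ Z, ‖gradA A (Fin.tail z)‖⁻¹) := by
        rw [← ENNReal.ofReal_sum_of_nonneg fun z _ => by positivity, Finset.mul_sum]
    _ ≤ ENNReal.ofReal (K * (Q ^ (s + m) * δ)) := by
        refine ENNReal.ofReal_le_ofReal ((mul_le_mul_of_nonneg_left hsumZ (by positivity)).trans ?_)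
        rw [hT, mul_pow C Q, hK, add_mul]
        have : 0 ≤ K₀ * C ^ v * (Q ^ (s + m) * δ) := by positivity
        linarith

/-- Convergence case of the Khintchine–Groshev theorem on the affine subspace
`H = {(x, x̃A)}` (here `n = s + m`). -/
theorem KG_convergence_affine (s m : ℕ) (hs : 1 ≤ s) (hm : 1 ≤ m)
    (A : Matrix (Fin (s + 1)) (Fin m) ℝ) (hA : DiophCond s m A)
    (ψ : ℝ → ℝ) (hmono : AntitoneOn ψ (Ici 0)) (hnn : ∀ x ∈ Ici (0 : ℝ), 0 ≤ ψ x)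
    (hsum : Summable fun q : {q : Fin (s + m) → ℤ // q ≠ 0} => ψ (‖q.1‖ ^ (s + m)))
    (x₀ : EuclideanSpace ℝ (Fin s)) (r : ℝ) (hr : 0 < r) :
    volume {x ∈ ball x₀ r |
      {q : Fin (s + m) → ℤ |
        ∃ p : ℤ, |dotA A (fun i => x i) q + (p : ℝ)| < ψ (‖q‖ ^ (s + m))}.Infinite} = 0 := by
  have hR1 : (1 : ℝ) ≤ max 1 (‖x₀‖ + r) := le_max_left _ _
  set R : ℝ := max 1 (‖x₀‖ + r) with hR
  obtain ⟨v, K, hv0, hvn, hK, hblock⟩ := exists_volume_block_le hs hm hA hR1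
  set δ : ℕ → ℝ := fun t => ψ (((2 : ℝ) ^ t) ^ (s + m)) with hδ
  have hδ0 : ∀ t, 0 ≤ δ t := fun t => hnn _ (by rw [mem_Ici]; positivity)
  have hsumδ : Summable fun t : ℕ => ((2 : ℝ) ^ t) ^ (s + m) * δ t :=
    summable_dyadic (by omega) hmono hnn hsum
  obtain ⟨t₀, ht₀⟩ : ∃ t₀ : ℕ, ∀ t ≥ t₀, K * ((2 : ℝ) ^ (t + 1)) ^ v * δ t < 1 := by
    have h1 := (hsumδ.mul_left (K * 2 ^ v)).tendsto_atTop_zero.eventually_lt_const one_pos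
    obtain ⟨t₀, h2⟩ := Filter.eventually_atTop.1 h1
    refine ⟨t₀, fun t ht => lt_of_le_of_lt ?_ (h2 t ht)⟩
    rw [pow_succ, Real.mul_rpow (by positivity) (by positivity)]
    have h3 : ((2 : ℝ) ^ t) ^ v ≤ ((2 : ℝ) ^ t) ^ (s + m) := by
      rw [← Real.rpow_natCast _ (s + m)]
      exact Real.rpow_le_rpow_of_exponent_le (one_le_pow₀ (by norm_num)) hvn.le
    calc K * (((2 : ℝ) ^ t) ^ v * 2 ^ v) * δ t = K * 2 ^ v * (((2 : ℝ) ^ t) ^ v * δ t) := by ring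
      _ ≤ _ := mul_le_mul_of_nonneg_left (mul_le_mul_of_nonneg_right h3 (hδ0 t)) (by positivity)
  set P : ℕ → EuclideanSpace ℝ (Fin s) → Prop := fun t x => (∀ i, |x i| ≤ R) ∧
    ∃ q : Fin (s + m) → ℤ, q ≠ 0 ∧ (∀ i, |(q i : ℝ)| ≤ 2 ^ (t + t₀ + 1)) ∧
      ∃ p : ℤ, |dotA A (fun i => x i) q + p| < δ (t + t₀) with hP
  have hvol : ∑' t, volume {x | P t x} ≠ ∞ := by
    have h1 : Summable fun t => K * (((2 : ℝ) ^ (t + t₀ + 1)) ^ (s + m) * δ (t + t₀)) := by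
      refine (((summable_nat_add_iff t₀).2 hsumδ).mul_left (K * 2 ^ (s + m))).congr fun t => ?_
      rw [pow_succ 2 (t + t₀), mul_pow]
      ring
    exact ne_top_of_le_ne_top h1.tsum_ofReal_ne_top (ENNReal.tsum_le_tsum fun t =>
      hblock _ _ (one_le_pow₀ (by norm_num)) (hδ0 _) (ht₀ _ (by omega)))
  refine measure_mono_null ?_ (measure_setOfPred_frequently_eq_zero hvol)
  rintro x ⟨hx, hinf⟩
  have hxR : ∀ i, |x i| ≤ R := fun i => by
    refine (PiLp.norm_apply_le x i).trans ?_
    have h1 := norm_sub_norm_le x x₀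
    have h2 := mem_ball_iff_norm.1 hx
    exact le_trans (by linarith) (le_max_right 1 (‖x₀‖ + r))
  refine Filter.frequently_atTop.2 fun a => ?_
  obtain ⟨q, ⟨p, hp⟩, hq⟩ := (hinf.sdiff
    (isCompact_closedBall (0 : Fin (s + m) → ℤ) (2 ^ (a + t₀))).finite_of_discrete).nonempty
  rw [mem_closedBall_zero_iff, not_le] at hq
  have hq1 : 1 ≤ ‖q‖ := (one_le_pow₀ (by norm_num)).trans hq.le
  obtain ⟨t, ht1, ht2⟩ := exists_nat_pow_near hq1 (one_lt_two : (1 : ℝ) < 2)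
  have hat : a + t₀ < t + 1 := (pow_lt_pow_iff_right₀ (one_lt_two : (1 : ℝ) < 2)).1 (hq.trans ht2)
  obtain ⟨b, rfl⟩ : ∃ b, t = b + t₀ := ⟨t - t₀, by omega⟩
  refine ⟨b, by omega, hxR, q, ?_, fun i => ?_, p, hp.trans_le ?_⟩
  · rintro rfl
    rw [norm_zero] at hq1
    linarith
  · rw [← Int.norm_eq_abs]
    exact (norm_le_pi_norm q i).trans ht2.le
  · exact hmono (by rw [mem_Ici]; positivity) (by rw [mem_Ici]; positivity)
      (pow_le_pow_left₀ (by positivity) ht1 _)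

end
end
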